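/- Let 1 ≤ p < ∞, m ∈ ℕ, a ∈ ℝ and 0 ≤ ℓ < d. If a ≥ d/p and either 1 < p < ∞ and m > d/p, or p = 1 and m ≥ d, then the Kondratiev space 𝒦^m_{a,p}(ℝ^d,ℝ^ℓ_*) is an algebra with respect to pointwise multiplication: there exists a constant c such that ‖u·v | 𝒦^m_{a,p}(ℝ^d,ℝ^ℓ_*)‖ ≤ c ‖u | 𝒦^m_{a,p}(ℝ^d,ℝ^ℓ_*)‖ · ‖v | 𝒦^m_{a,p}(ℝ^d,ℝ^ℓ_*)‖ holds for all u, v ∈ 𝒦^m_{a,p}(ℝ^d,ℝ^ℓ_*). -/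

import Mathlib

open MeasureTheory Metric Set Filter
open scoped Topology ENNReal NNReal

noncomputable section

/-- `d`-dimensional Euclidean space. -/
abbrev Ed (d : ℕ) : Type := EuclideanSpace ℝ (Fin d)

/-- The finite set of all multi-indices `α : Fin d → ℕ` with `|α| = ∑ i, α i ≤ m`. -/
def multiIdx (d m : ℕ) : Finset (Fin d → ℕ) :=
  (Fintype.piFinset fun _ : Fin d => Finset.range (m + 1)).filter fun α => ∑ i, α i ≤ m

/-- First-order partial derivative in the `i`-th coordinate direction. -/
def pderivI (d : ℕ) (i : Fin d) (f : Ed d → ℝ) : Ed d → ℝ :=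
  fun x => fderiv ℝ f x (EuclideanSpace.single i 1)

/-- Iterated partial derivative `∂^α`. -/
def pderivA (d : ℕ) (α : Fin d → ℕ) (f : Ed d → ℝ) : Ed d → ℝ :=
  ((List.finRange d).foldr (fun i g => (pderivI d i)^[α i] ∘ g) id) f

/-- Smooth compactly supported test functions with support inside `Ω`. -/
def IsTestFun (d : ℕ) (Ω : Set (Ed d)) (φ : Ed d → ℝ) : Prop :=
  ContDiff ℝ (⊤ : ℕ∞) φ ∧ HasCompactSupport φ ∧ tsupport φ ⊆ Ω

/-- `v` is the `α`-th weak (distributional) derivative of `u` on `Ω`. -/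
def HasWeakDerivOn (d : ℕ) (Ω : Set (Ed d)) (α : Fin d → ℕ) (u v : Ed d → ℝ) : Prop :=
  LocallyIntegrableOn u Ω volume ∧ LocallyIntegrableOn v Ω volume ∧
    ∀ φ : Ed d → ℝ, IsTestFun d Ω φ →
      ∫ x in Ω, u x * pderivA d α φ x = (-1 : ℝ) ^ (∑ i, α i) * ∫ x in Ω, v x * φ x

/-- `D` is a family of weak derivatives of `u` on `Ω` for all multi-indices of order `≤ m`. -/
def IsWeakDerivFamily (d : ℕ) (Ω : Set (Ed d)) (m : ℕ) (u : Ed d → ℝ)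
    (D : (Fin d → ℕ) → Ed d → ℝ) : Prop :=
  ∀ α ∈ multiIdx d m, HasWeakDerivOn d Ω α u (D α)

/-- `x ↦ (ρ(x)^(|α|-a) |v(x)|)^p`, the integrand in the Kondratiev norm. -/
def kIntegrand (d : ℕ) (ρ : Ed d → ℝ) (a p : ℝ) (α : Fin d → ℕ) (v : Ed d → ℝ) : Ed d → ℝ :=
  fun x => (ρ x ^ (((∑ i, α i : ℕ) : ℝ) - a) * |v x|) ^ p

/-- The Kondratiev norm computed from a family `D` of weak derivatives. -/
def KnormP (d : ℕ) (Ω : Set (Ed d)) (ρ : Ed d → ℝ) (m : ℕ) (a p : ℝ)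
    (D : (Fin d → ℕ) → Ed d → ℝ) : ℝ :=
  (∑ α ∈ multiIdx d m, ∫ x in Ω, kIntegrand d ρ a p α (D α) x) ^ (1 / p)

/-- `D` witnesses membership of `u` in the Kondratiev space `𝒦^m_{a,p}(Ω, M)`
    (with weight function `ρ`). -/
def KMemData (d : ℕ) (Ω : Set (Ed d)) (ρ : Ed d → ℝ) (m : ℕ) (a p : ℝ)
    (u : Ed d → ℝ) (D : (Fin d → ℕ) → Ed d → ℝ) : Prop :=
  IsWeakDerivFamily d Ω m u D ∧
    ∀ α ∈ multiIdx d m, IntegrableOn (kIntegrand d ρ a p α (D α)) Ω volume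

/-- Membership in the Kondratiev space `𝒦^m_{a,p}(Ω, M)` with weight `ρ`, `p < ∞`. -/
def MemK (d : ℕ) (Ω : Set (Ed d)) (ρ : Ed d → ℝ) (m : ℕ) (a p : ℝ) (u : Ed d → ℝ) : Prop :=
  ∃ D, KMemData d Ω ρ m a p u D

open Classical in
/-- The Kondratiev norm of `u` (computed from a choice of weak derivative family;
    it is a.e. independent of this choice). -/
def Knorm (d : ℕ) (Ω : Set (Ed d)) (ρ : Ed d → ℝ) (m : ℕ) (a p : ℝ) (u : Ed d → ℝ) : ℝ :=
  if h : MemK d Ω ρ m a p u then KnormP d Ω ρ m a p h.choose else 0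

/-- `x ↦ ρ(x)^(|α|-a) v(x)`, the function whose `L_∞` norm enters the norm for `p = ∞`. -/
def kIntegrandInf (d : ℕ) (ρ : Ed d → ℝ) (a : ℝ) (α : Fin d → ℕ) (v : Ed d → ℝ) : Ed d → ℝ :=
  fun x => ρ x ^ (((∑ i, α i : ℕ) : ℝ) - a) * v x

/-- `D` witnesses membership of `u` in `𝒦^m_{a,∞}(Ω, M)`. -/
def KMemDataInf (d : ℕ) (Ω : Set (Ed d)) (ρ : Ed d → ℝ) (m : ℕ) (a : ℝ)
    (u : Ed d → ℝ) (D : (Fin d → ℕ) → Ed d → ℝ) : Prop :=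
  IsWeakDerivFamily d Ω m u D ∧
    ∀ α ∈ multiIdx d m,
      eLpNorm (kIntegrandInf d ρ a α (D α)) ⊤ (volume.restrict Ω) < ⊤

/-- Membership in `𝒦^m_{a,∞}(Ω, M)`. -/
def MemKInf (d : ℕ) (Ω : Set (Ed d)) (ρ : Ed d → ℝ) (m : ℕ) (a : ℝ) (u : Ed d → ℝ) : Prop :=
  ∃ D, KMemDataInf d Ω ρ m a u D

/-- The `𝒦^m_{a,∞}` norm computed from a family `D` of weak derivatives. -/
def KnormInfP (d : ℕ) (Ω : Set (Ed d)) (ρ : Ed d → ℝ) (m : ℕ) (a : ℝ)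
    (D : (Fin d → ℕ) → Ed d → ℝ) : ℝ :=
  ∑ α ∈ multiIdx d m, (eLpNorm (kIntegrandInf d ρ a α (D α)) ⊤ (volume.restrict Ω)).toReal

open Classical in
/-- The `𝒦^m_{a,∞}(Ω, M)` norm of `u`. -/
def KnormInf (d : ℕ) (Ω : Set (Ed d)) (ρ : Ed d → ℝ) (m : ℕ) (a : ℝ) (u : Ed d → ℝ) : ℝ :=
  if h : MemKInf d Ω ρ m a u then KnormInfP d Ω ρ m a h.choose else 0

/-- The subspace `ℝ^ℓ_* = {x : x₁ = ⋯ = x_{d-ℓ} = 0}` of `ℝ^d`. -/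
def RStar (d ℓ : ℕ) : Set (Ed d) := {x | ∀ i : Fin d, (i : ℕ) < d - ℓ → x i = 0}

/-- The weight `ρ(x) = min(1, |x'|)` for the model case `(ℝ^d, ℝ^ℓ_*)`. -/
def rhoModel (d ℓ : ℕ) (x : Ed d) : ℝ :=
  min 1 (Real.sqrt (∑ i ∈ Finset.univ.filter (fun i : Fin d => (i : ℕ) < d - ℓ), (x i) ^ 2))

/-- The model domain `ℝ^d ∖ ℝ^ℓ_*`. -/
def ModelDomain (d ℓ : ℕ) : Set (Ed d) := (RStar d ℓ)ᶜ

/-- Membership in the model Kondratiev space `𝒦^m_{a,p}(ℝ^d, ℝ^ℓ_*)`, `p < ∞`. -/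
def MemKM (d ℓ m : ℕ) (a p : ℝ) (u : Ed d → ℝ) : Prop :=
  MemK d (ModelDomain d ℓ) (rhoModel d ℓ) m a p u

/-- The norm of the model Kondratiev space `𝒦^m_{a,p}(ℝ^d, ℝ^ℓ_*)`, `p < ∞`. -/
def KnormM (d ℓ m : ℕ) (a p : ℝ) (u : Ed d → ℝ) : ℝ :=
  Knorm d (ModelDomain d ℓ) (rhoModel d ℓ) m a p u

/-- Membership in the model Kondratiev space `𝒦^m_{a,∞}(ℝ^d, ℝ^ℓ_*)`. -/
def MemKMInf (d ℓ m : ℕ) (a : ℝ) (u : Ed d → ℝ) : Prop :=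
  MemKInf d (ModelDomain d ℓ) (rhoModel d ℓ) m a u

/-- The norm of the model Kondratiev space `𝒦^m_{a,∞}(ℝ^d, ℝ^ℓ_*)`. -/
def KnormMInf (d ℓ m : ℕ) (a : ℝ) (u : Ed d → ℝ) : ℝ :=
  KnormInf d (ModelDomain d ℓ) (rhoModel d ℓ) m a u

/-! ### Partial derivatives of smooth functions -/

/-- Smoothness abbreviation. -/
abbrev Sm {d : ℕ} (f : Ed d → ℝ) : Prop := ContDiff ℝ (⊤ : ℕ∞) f

/-- Unit multi-index. -/
abbrev eI {d : ℕ} (i : Fin d) : Fin d → ℕ := Pi.single i 1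

/-- Order of a multi-index. -/
abbrev ord {d : ℕ} (α : Fin d → ℕ) : ℕ := ∑ i, α i

lemma ord_add {d : ℕ} (α β : Fin d → ℕ) : ord (α + β) = ord α + ord β := by
  simp [ord, Finset.sum_add_distrib]

lemma ord_eI {d : ℕ} (i : Fin d) : ord (eI i) = 1 := by
  simp [ord, eI]

lemma mem_multiIdx {d m : ℕ} {α : Fin d → ℕ} : α ∈ multiIdx d m ↔ ord α ≤ m := by
  simp only [multiIdx, Finset.mem_filter, Fintype.mem_piFinset, Finset.mem_range, ord]
  refine ⟨fun h => h.2, fun h => ⟨fun i => ?_, h⟩⟩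
  have := Finset.single_le_sum (f := α) (fun i _ => Nat.zero_le _) (Finset.mem_univ i)
  omega

lemma multi_induction {d : ℕ} {P : (Fin d → ℕ) → Prop} (h0 : P 0)
    (hs : ∀ α i, P α → P (α + eI i)) (α : Fin d → ℕ) : P α := by
  induction hn : ord α using Nat.strong_induction_on generalizing α with
  | _ n ih =>
    by_cases h : α = 0
    · rwa [h]
    · obtain ⟨i, hi⟩ : ∃ i, α i ≠ 0 := by
        by_contra hc; push Not at hc; exact h (funext hc)
      have e : α = (α - eI i) + eI i := by
        funext j
        by_cases hj : j = i
        · subst hj; simp; omega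
        · simp [hj]
      rw [e]
      apply hs
      apply ih _ _ _ rfl
      have := ord_add (α - eI i) (eI i)
      rw [← e, ord_eI] at this
      omega

lemma sm_pderivI {d : ℕ} (i : Fin d) {f : Ed d → ℝ} (hf : Sm f) : Sm (pderivI d i f) := by
  unfold pderivI
  exact (hf.fderiv_right (m := ((⊤ : ℕ∞) : WithTop ℕ∞)) (by simp)).clm_apply contDiff_const

lemma sm_diff {d : ℕ} {f : Ed d → ℝ} (hf : Sm f) : Differentiable ℝ f :=
  hf.differentiable (by simp)

lemma pderivI_comm {d : ℕ} (i j : Fin d) {f : Ed d → ℝ} (hf : Sm f) :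
    pderivI d i (pderivI d j f) = pderivI d j (pderivI d i f) := by
  funext x
  have h2 : Differentiable ℝ (fderiv ℝ f) :=
    (hf.fderiv_right (m := ((⊤ : ℕ∞) : WithTop ℕ∞)) (by simp)).differentiable (by simp)
  have key : ∀ k l : Fin d, pderivI d k (pderivI d l f) x
      = fderiv ℝ (fderiv ℝ f) x (EuclideanSpace.single k 1) (EuclideanSpace.single l 1) := by
    intro k l
    unfold pderivI
    rw [fderiv_clm_apply (h2 x) (differentiableAt_const _)]
    simp
  rw [key, key]
  have hs : IsSymmSndFDerivAt ℝ f x := (hf.contDiffAt).isSymmSndFDerivAt (by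
    simp only [minSmoothness_of_isRCLikeNormedField]; exact WithTop.coe_le_coe.2 (le_top : (2 : ℕ∞) ≤ ⊤))
  exact hs _ _

lemma sm_iter {d : ℕ} (i : Fin d) (k : ℕ) {f : Ed d → ℝ} (hf : Sm f) :
    Sm ((pderivI d i)^[k] f) := by
  induction k with
  | zero => simpa
  | succ k ih => rw [Function.iterate_succ_apply']; exact sm_pderivI i ih

lemma pderivI_iter_comm {d : ℕ} (i j : Fin d) (k : ℕ) {f : Ed d → ℝ} (hf : Sm f) :
    (pderivI d j)^[k] (pderivI d i f) = pderivI d i ((pderivI d j)^[k] f) := by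
  induction k with
  | zero => rfl
  | succ k ih =>
    rw [Function.iterate_succ_apply', Function.iterate_succ_apply', ih,
      pderivI_comm _ _ (sm_iter j k hf)]

/-- Partial derivative along a list. -/
def pdL (d : ℕ) (α : Fin d → ℕ) (L : List (Fin d)) : (Ed d → ℝ) → (Ed d → ℝ) :=
  L.foldr (fun i g => (pderivI d i)^[α i] ∘ g) id

lemma pdL_cons {d : ℕ} (α : Fin d → ℕ) (j : Fin d) (L : List (Fin d)) (f : Ed d → ℝ) :
    pdL d α (j :: L) f = (pderivI d j)^[α j] (pdL d α L f) := rfl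

lemma sm_pdL {d : ℕ} (α : Fin d → ℕ) (L : List (Fin d)) {f : Ed d → ℝ} (hf : Sm f) :
    Sm (pdL d α L f) := by
  induction L with
  | nil => exact hf
  | cons j L ih => rw [pdL_cons]; exact sm_iter _ _ ih

lemma sm_pderivA {d : ℕ} (α : Fin d → ℕ) {f : Ed d → ℝ} (hf : Sm f) : Sm (pderivA d α f) :=
  sm_pdL α _ hf

lemma pdL_not_mem {d : ℕ} (α : Fin d → ℕ) (i : Fin d) (L : List (Fin d)) (h : i ∉ L)
    (f : Ed d → ℝ) : pdL d (α + eI i) L f = pdL d α L f := by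
  induction L with
  | nil => rfl
  | cons j L ih =>
    have hj : j ≠ i := fun e => h (by simp [e])
    rw [pdL_cons, pdL_cons, ih (fun hh => h (List.mem_cons_of_mem _ hh))]
    simp [hj]

lemma pdL_mem {d : ℕ} (α : Fin d → ℕ) (i : Fin d) (L : List (Fin d)) (h : i ∈ L)
    (hn : L.Nodup) {f : Ed d → ℝ} (hf : Sm f) :
    pdL d (α + eI i) L f = pderivI d i (pdL d α L f) := by
  induction L with
  | nil => simp at h
  | cons j L ih =>
    rw [List.nodup_cons] at hn
    rw [pdL_cons, pdL_cons]
    by_cases hj : j = i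
    · subst hj
      rw [pdL_not_mem _ _ _ hn.1]
      simp only [Pi.add_apply, Pi.single_eq_same, eI]
      rw [Function.iterate_succ_apply']
    · have hi : i ∈ L := by
        rcases List.mem_cons.1 h with h | h
        · exact absurd h.symm hj
        · exact h
      rw [ih hi hn.2]
      simp only [Pi.add_apply, eI, Pi.single_eq_of_ne hj, add_zero]
      exact pderivI_iter_comm _ _ _ (sm_pdL _ _ hf)

lemma pderivA_succ {d : ℕ} (α : Fin d → ℕ) (i : Fin d) {f : Ed d → ℝ} (hf : Sm f) :
    pderivA d (α + eI i) f = pderivI d i (pderivA d α f) :=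
  pdL_mem α i _ (List.mem_finRange i) (List.nodup_finRange d) hf

lemma pderivA_zero {d : ℕ} (f : Ed d → ℝ) : pderivA d 0 f = f := by
  have : ∀ L : List (Fin d), pdL d 0 L f = f := by
    intro L
    induction L with
    | nil => rfl
    | cons j L ih => rw [pdL_cons, ih]; rfl
  exact this _

lemma pderivA_add {d : ℕ} (α β : Fin d → ℕ) {f : Ed d → ℝ} (hf : Sm f) :
    pderivA d α (pderivA d β f) = pderivA d (β + α) f := by
  induction α using multi_induction with
  | h0 => rw [pderivA_zero, add_zero]
  | hs α i ih => rw [pderivA_succ _ _ (sm_pderivA _ hf), ih, ← add_assoc, pderivA_succ _ _ hf]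

lemma pderivA_eI {d : ℕ} (i : Fin d) {f : Ed d → ℝ} (hf : Sm f) :
    pderivA d (eI i) f = pderivI d i f := by
  have := pderivA_succ 0 i hf
  rwa [zero_add, pderivA_zero] at this

/-! Linearity, product rule -/

lemma sm_add {d : ℕ} {f g : Ed d → ℝ} (hf : Sm f) (hg : Sm g) : Sm (f + g) := hf.add hg
lemma sm_sub {d : ℕ} {f g : Ed d → ℝ} (hf : Sm f) (hg : Sm g) : Sm (f - g) := hf.sub hg
lemma sm_mul {d : ℕ} {f g : Ed d → ℝ} (hf : Sm f) (hg : Sm g) : Sm (f * g) := hf.mul hg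

lemma pderivI_add {d : ℕ} (i : Fin d) {f g : Ed d → ℝ} (hf : Sm f) (hg : Sm g) :
    pderivI d i (f + g) = pderivI d i f + pderivI d i g := by
  funext x
  simp only [pderivI, Pi.add_apply]
  rw [fderiv_add (sm_diff hf x) (sm_diff hg x)]; rfl

lemma pderivI_sub {d : ℕ} (i : Fin d) {f g : Ed d → ℝ} (hf : Sm f) (hg : Sm g) :
    pderivI d i (f - g) = pderivI d i f - pderivI d i g := by
  funext x
  simp only [pderivI, Pi.sub_apply]
  rw [fderiv_sub (sm_diff hf x) (sm_diff hg x)]; rfl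

lemma pderivA_sub {d : ℕ} (α : Fin d → ℕ) {f g : Ed d → ℝ} (hf : Sm f) (hg : Sm g) :
    pderivA d α (f - g) = pderivA d α f - pderivA d α g := by
  induction α using multi_induction with
  | h0 => simp [pderivA_zero]
  | hs α i ih =>
    rw [pderivA_succ _ _ hf, pderivA_succ _ _ hg, pderivA_succ _ _ (sm_sub hf hg), ih,
      pderivI_sub _ (sm_pderivA _ hf) (sm_pderivA _ hg)]

lemma pderivI_mul {d : ℕ} (i : Fin d) {f g : Ed d → ℝ} (hf : Sm f) (hg : Sm g) :
    pderivI d i (f * g) = pderivI d i f * g + f * pderivI d i g := by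
  funext x
  simp only [pderivI, Pi.add_apply, Pi.mul_apply]
  rw [fderiv_mul (sm_diff hf x) (sm_diff hg x)]
  simp
  ring

/-- Sum over a list of pairs of products of derivatives. -/
def lsum {d : ℕ} (L : List ((Fin d → ℕ) × (Fin d → ℕ))) (D E : (Fin d → ℕ) → Ed d → ℝ) :
    Ed d → ℝ := fun x => (L.map fun q => D q.1 x * E q.2 x).sum

lemma leibniz {d : ℕ} (α : Fin d → ℕ) : ∃ L : List ((Fin d → ℕ) × (Fin d → ℕ)),
    (∀ q ∈ L, ord q.1 + ord q.2 = ord α) ∧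
    ∀ f g : Ed d → ℝ, Sm f → Sm g →
      pderivA d α (f * g) = lsum L (fun β => pderivA d β f) (fun β => pderivA d β g) := by
  induction α using multi_induction with
  | h0 =>
    refine ⟨[(0, 0)], by simp [ord], fun f g hf hg => ?_⟩
    funext x
    simp [lsum, pderivA_zero]
  | hs α i ih =>
    obtain ⟨L, hL, h⟩ := ih
    refine ⟨L.map (fun q => (q.1 + eI i, q.2)) ++ L.map (fun q => (q.1, q.2 + eI i)), ?_, ?_⟩
    · intro q hq
      rw [List.mem_append, List.mem_map, List.mem_map] at hq
      rw [ord_add, ord_eI]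
      rcases hq with ⟨r, hr, rfl⟩ | ⟨r, hr, rfl⟩
      · simp only [ord_add, ord_eI]; have := hL r hr; omega
      · simp only [ord_add, ord_eI]; have := hL r hr; omega
    · intro f g hf hg
      rw [pderivA_succ _ _ (sm_mul hf hg), h f g hf hg]
      clear h hL
      have smL : ∀ L : List ((Fin d → ℕ) × (Fin d → ℕ)),
          Sm (lsum L (fun β => pderivA d β f) (fun β => pderivA d β g)) := by
        intro L
        induction L with
        | nil => exact contDiff_const
        | cons q L ih => exact ((sm_pderivA _ hf).mul (sm_pderivA _ hg)).add ih
      induction L with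
      | nil =>
        have e0 : lsum [] (fun β => pderivA d β f) (fun β => pderivA d β g) = fun _ => 0 := rfl
        funext x; simp [e0, pderivI, lsum]
      | cons q L ih =>
        have e : lsum (q :: L) (fun β => pderivA d β f) (fun β => pderivA d β g)
          = pderivA d q.1 f * pderivA d q.2 g
            + lsum L (fun β => pderivA d β f) (fun β => pderivA d β g) := rfl
        rw [e, pderivI_add _ (sm_mul (sm_pderivA _ hf) (sm_pderivA _ hg)) (smL L), ih,
          pderivI_mul _ (sm_pderivA _ hf) (sm_pderivA _ hg)]
        funext x
        simp only [lsum, List.map_append, List.sum_append, List.map_map, Pi.add_apply,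
          Pi.mul_apply, List.map_cons, List.sum_cons, pderivA_succ _ _ hf, pderivA_succ _ _ hg]
        ring

/-! Locality and supports -/

lemma pderivI_tsupport {d : ℕ} (i : Fin d) (f : Ed d → ℝ) :
    tsupport (pderivI d i f) ⊆ tsupport f := by
  refine (closure_mono ?_).trans (tsupport_fderiv_subset ℝ (f := f))
  intro x hx
  rw [Function.mem_support] at *
  intro h
  exact hx (by simp [pderivI, h])

lemma pderivA_tsupport {d : ℕ} (α : Fin d → ℕ) {f : Ed d → ℝ} (hf : Sm f) :
    tsupport (pderivA d α f) ⊆ tsupport f := by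
  induction α using multi_induction with
  | h0 => rw [pderivA_zero]
  | hs α i ih => rw [pderivA_succ _ _ hf]; exact (pderivI_tsupport _ _).trans ih

lemma pderivI_eqOn {d : ℕ} (i : Fin d) {f g : Ed d → ℝ} {s : Set (Ed d)} (hs : IsOpen s)
    (h : EqOn f g s) : EqOn (pderivI d i f) (pderivI d i g) s := by
  intro x hx
  have : f =ᶠ[𝓝 x] g := Filter.eventually_of_mem (hs.mem_nhds hx) h
  simp only [pderivI, this.fderiv_eq]

lemma pderivA_eqOn {d : ℕ} (α : Fin d → ℕ) {f g : Ed d → ℝ} (hf : Sm f) (hg : Sm g)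
    {s : Set (Ed d)} (hs : IsOpen s)
    (h : EqOn f g s) : EqOn (pderivA d α f) (pderivA d α g) s := by
  induction α using multi_induction with
  | h0 => rwa [pderivA_zero, pderivA_zero]
  | hs α i ih => rw [pderivA_succ _ _ hf, pderivA_succ _ _ hg]; exact pderivI_eqOn i hs ih

/-! Scaling -/

lemma pderivA_affine {d : ℕ} (α : Fin d → ℕ) {f : Ed d → ℝ} (hf : Sm f) (y : Ed d) (r : ℝ) :
    pderivA d α (fun z => f (y + r • z)) = fun z => r ^ ord α * pderivA d α f (y + r • z) := by
  have sm : ∀ g : Ed d → ℝ, Sm g → Sm (fun z => g (y + r • z)) := fun g hg =>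
    hg.comp (contDiff_const.add (contDiff_id.const_smul r))
  induction α using multi_induction with
  | h0 => simp [pderivA_zero, ord]
  | hs α i ih =>
    rw [pderivA_succ _ _ hf, pderivA_succ _ _ (sm f hf), ih]
    funext z
    have hA : HasFDerivAt (fun z : Ed d => y + r • z) (r • ContinuousLinearMap.id ℝ (Ed d)) z :=
      ((hasFDerivAt_id z).const_smul r).const_add y
    have h1 := ((sm_diff (sm_pderivA α hf) (y + r • z)).hasFDerivAt.comp z hA).const_mul
      (r ^ ord α)
    unfold pderivI
    have h2 : fderiv ℝ (fun z => r ^ ord α * pderivA d α f (y + r • z)) z = _ := h1.fderiv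
    rw [h2, ord_add, ord_eI]
    simp
    ring

/-- Integration by parts. -/
lemma pderivA_ibp {d : ℕ} (α : Fin d → ℕ) {w φ : Ed d → ℝ} (hw : Sm w) (hφ : Sm φ)
    (hc : HasCompactSupport φ) :
    ∫ x, w x * pderivA d α φ x = (-1 : ℝ) ^ ord α * ∫ x, pderivA d α w x * φ x := by
  induction α using multi_induction generalizing w with
  | h0 => simp [pderivA_zero, ord]
  | hs α i ih =>
    have hcA : HasCompactSupport (pderivA d α φ) :=
      hc.of_isClosed_subset (isClosed_tsupport _) (pderivA_tsupport α hφ)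
    have hcI : HasCompactSupport (pderivI d i (pderivA d α φ)) :=
      hcA.of_isClosed_subset (isClosed_tsupport _) (pderivI_tsupport i _)
    have cA := (sm_pderivA α hφ).continuous
    have cI := (sm_pderivI i (sm_pderivA α hφ)).continuous
    have cw := (sm_pderivI i hw).continuous
    rw [pderivA_succ _ _ hφ]
    have := integral_mul_fderiv_eq_neg_fderiv_mul_of_integrable (μ := (volume : Measure (Ed d)))
      (f := w) (g := pderivA d α φ) (v := EuclideanSpace.single i 1)
      ((cw.mul cA).integrable_of_hasCompactSupport (hcA.mul_left))
      ((hw.continuous.mul cI).integrable_of_hasCompactSupport (hcI.mul_left))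
      ((hw.continuous.mul cA).integrable_of_hasCompactSupport (hcA.mul_left))
      (fun x _ => sm_diff hw x) (fun x _ => sm_diff (sm_pderivA α hφ) x)
    have e1 : ∫ x, w x * pderivI d i (pderivA d α φ) x
      = - ∫ x, pderivI d i w x * pderivA d α φ x := this
    rw [e1, ih (sm_pderivI i hw), ord_add, ord_eI, pow_succ]
    have e2 : pderivA d α (pderivI d i w) = pderivA d (α + eI i) w := by
      rw [← pderivA_eI i hw, pderivA_add _ _ hw, add_comm]
    rw [e2, pderivA_succ _ _ hw]
    ring

/-! ### Sobolev inequalities for test functions -/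

lemma lint_affine {d : ℕ} (F : Ed d → ℝ≥0∞) (y : Ed d) {r : ℝ} (hr : r ≠ 0) :
    ∫⁻ z, F (y + r • z) = ENNReal.ofReal (|r| ^ d)⁻¹ * ∫⁻ z, F z := by
  have h1 : ∫⁻ z, F (y + r • z) = ∫⁻ z, F (y + z) ∂(Measure.map (r • ·) volume) := by
    have := lintegral_map_equiv (μ := (volume : Measure (Ed d))) (fun z => F (y + z))
      (MeasurableEquiv.smul₀ r hr)
    exact this.symm
  rw [h1, Measure.map_addHaar_smul _ hr, lintegral_smul_measure, lintegral_add_left_eq_self]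
  simp [abs_inv, abs_pow]

lemma pi_lint {d : ℕ} (F : Ed d → ℝ≥0∞) :
    ∫⁻ z : Fin d → ℝ, F (WithLp.toLp 2 z) = ∫⁻ z, F z :=
  (PiLp.volume_preserving_toLp (Fin d)).lintegral_comp_emb
    (MeasurableEquiv.toLp 2 (Fin d → ℝ)).measurableEmbedding F

/-- indicator multi-index. -/
def indI {d : ℕ} (s : Finset (Fin d)) : Fin d → ℕ := fun i => if i ∈ s then 1 else 0

lemma sup_le_L1_aux {d : ℕ} {f : Ed d → ℝ} (hf : Sm f) (hc : HasCompactSupport f)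
    (s : Finset (Fin d)) (x : Fin d → ℝ) :
    ‖f (WithLp.toLp 2 x)‖ₑ ≤ lmarginal (fun _ => volume) s
      (fun z => ‖pderivA d (indI s) f (WithLp.toLp 2 z)‖ₑ) x := by
  induction s using Finset.induction_on generalizing x with
  | empty =>
    have : indI (∅ : Finset (Fin d)) = 0 := by funext i; simp [indI]
    rw [this, pderivA_zero, lmarginal_empty]
  | insert i s hi ih =>
    have hh : indI (insert i s) = indI s + eI i := by
      funext j
      by_cases hj : j = i
      · subst hj; simp [indI, hi]
      · simp [indI, hj]
    rw [hh, pderivA_succ _ _ hf]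
    set g := pderivA d (indI s) f with hg
    have sg : Sm g := sm_pderivA _ hf
    have cg : HasCompactSupport g := hc.of_isClosed_subset (isClosed_tsupport _)
      (pderivA_tsupport _ hf)
    have cI : Continuous (pderivI d i g) := (sm_pderivI i sg).continuous
    rw [lmarginal_insert' _ (by
      exact (cI.comp (PiLp.continuous_toLp 2 _)).enorm.measurable) hi]
    refine (ih x).trans (lmarginal_mono ?_ x)
    intro z
    have hd : ∀ t, HasDerivAt (fun t => g (WithLp.toLp 2 (Function.update z i t)))
        (pderivI d i g (WithLp.toLp 2 (Function.update z i t))) t := by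
      intro t
      have h1 := hasDerivAt_update z i t
      have h2 : HasDerivAt (fun t => (WithLp.toLp 2 (Function.update z i t) : Ed d))
          (WithLp.toLp 2 (Pi.single i 1)) t :=
        ((EuclideanSpace.equiv (Fin d) ℝ).symm.hasFDerivAt.comp_hasDerivAt t h1)
      exact ((sm_diff sg _).hasFDerivAt.comp_hasDerivAt t h2)
    have e1 : ContDiff ℝ 1 (fun t => g (WithLp.toLp 2 (Function.update z i t))) := by
      have : ContDiff ℝ 1 (fun t => (WithLp.toLp 2 (Function.update z i t) : Ed d)) :=
        (EuclideanSpace.equiv (Fin d) ℝ).symm.contDiff.comp (contDiff_update 1 z i)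
      exact (sg.of_le (by exact_mod_cast le_top)).comp this
    have e2 : HasCompactSupport (fun t => g (WithLp.toLp 2 (Function.update z i t))) := by
      have hemb : Topology.IsClosedEmbedding
          (fun t => (WithLp.toLp 2 (Function.update z i t) : Ed d)) :=
        (PiLp.homeomorph 2 (fun _ : Fin d => ℝ)).symm.isClosedEmbedding.comp
          (isClosedEmbedding_update z i)
      exact cg.comp_isClosedEmbedding hemb
    have h3 := HasCompactSupport.enorm_le_lintegral_Ici_deriv e1 e2 (z i)
    simp only [Function.update_eq_self] at h3
    refine h3.trans ((lintegral_mono' Measure.restrict_le_self le_rfl).trans ?_)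
    refine lintegral_mono fun t => ?_
    rw [(hd t).deriv]

lemma sup_le_L1 {d : ℕ} {f : Ed d → ℝ} (hf : Sm f) (hc : HasCompactSupport f) (x : Ed d) :
    ‖f x‖ₑ ≤ eLpNorm (pderivA d (fun _ => 1) f) 1 volume := by
  have h := sup_le_L1_aux hf hc Finset.univ x.ofLp
  have hi : indI (Finset.univ : Finset (Fin d)) = fun _ => 1 := by funext i; simp [indI]
  rw [hi, lmarginal_univ] at h
  rw [eLpNorm_one_eq_lintegral_enorm, ← pi_lint]
  exact h

lemma lint_rpow_fin {s : ℝ} (hs : s < 1) (T : ℝ) (hT : 0 ≤ T) :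
    ∫⁻ t in Ioc (-T) 0, ENNReal.ofReal (|t| ^ (-s)) < ⊤ := by
  have h : IntervalIntegrable (fun t : ℝ => t ^ (-s)) volume 0 T :=
    intervalIntegral.intervalIntegrable_rpow' (by linarith)
  have h2 := h.comp_sub_left 0
  simp only [zero_sub, sub_zero] at h2
  have h3 := h2.symm
  rw [intervalIntegrable_iff_integrableOn_Ioc_of_le (by linarith)] at h3
  have h4 : IntegrableOn (fun t : ℝ => |t| ^ (-s)) (Ioc (-T) 0) := by
    refine h3.congr_fun (fun t ht => ?_) measurableSet_Ioc
    simp only [abs_of_nonpos ht.2]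
  have := h4.2
  rw [hasFiniteIntegral_iff_ofReal (ae_of_all _ fun t => by positivity)] at this
  exact this

lemma eLp_affine {d : ℕ} {F : Type*} [NormedAddCommGroup F] (h : Ed d → F) (y : Ed d) {t r : ℝ}
    (ht : t ≠ 0) (hr : 0 < r) :
    eLpNorm (fun z => h (y + t • z)) (ENNReal.ofReal r) volume
      = ENNReal.ofReal (|t| ^ (-((d : ℝ) / r))) * eLpNorm h (ENNReal.ofReal r) volume := by
  have h0 : ENNReal.ofReal r ≠ 0 := by simpa using hr
  rw [eLpNorm_eq_lintegral_rpow_enorm_toReal h0 ENNReal.ofReal_ne_top,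
    eLpNorm_eq_lintegral_rpow_enorm_toReal h0 ENNReal.ofReal_ne_top,
    ENNReal.toReal_ofReal hr.le, lint_affine (fun z => ‖h z‖ₑ ^ r) y ht,
    ENNReal.mul_rpow_of_nonneg _ _ (by positivity)]
  congr 1
  have ht' : 0 < |t| := abs_pos.2 ht
  rw [ENNReal.ofReal_rpow_of_nonneg (by positivity) (by positivity)]
  congr 1
  rw [← Real.rpow_natCast, ← Real.rpow_neg ht'.le, ← Real.rpow_mul ht'.le]
  congr 1
  ring

lemma morrey {d : ℕ} (hd : 2 ≤ d) {r : ℝ} (hr : (d : ℝ) < r) : ∃ C : ℝ≥0, ∀ f : Ed d → ℝ, Sm f →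
    tsupport f ⊆ closedBall 0 2 → ∀ x,
      ‖f x‖ₑ ≤ C * eLpNorm (fderiv ℝ f) (ENNReal.ofReal r) volume := by
  have hr0 : 0 < r := lt_of_le_of_lt (by positivity) hr
  have hr1 : 1 ≤ r := by
    have : (2 : ℝ) ≤ d := by exact_mod_cast hd
    linarith
  let e : Ed d := EuclideanSpace.single ⟨0, by omega⟩ 1
  have he : ‖e‖ = 1 := by simp [e]
  set A : Set (Ed d) := ball e (1 / 2) with hA
  have hA0 : volume A ≠ 0 := (measure_ball_pos _ _ (by norm_num)).ne'
  have hA1 : volume A ≠ ⊤ := measure_ball_lt_top.ne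
  have hs1 : (d : ℝ) / r < 1 := by rw [div_lt_one hr0]; exact hr
  set J := ∫⁻ t in Ioc (-10 : ℝ) 0, ENNReal.ofReal (|t| ^ (-((d : ℝ) / r))) with hJ
  have hJt : J < ⊤ := lint_rpow_fin hs1 10 (by norm_num)
  set K : ℝ≥0∞ := 2 * (volume A) ^ (1 - 1 / r) * J * (volume A)⁻¹ with hK
  have hKt : K ≠ ⊤ := by
    refine ENNReal.mul_ne_top (ENNReal.mul_ne_top (ENNReal.mul_ne_top (by simp) ?_) hJt.ne) ?_
    · refine ENNReal.rpow_ne_top_of_nonneg ?_ hA1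
      rw [sub_nonneg, div_le_one hr0]; exact hr1
    · simp [hA0]
  refine ⟨K.toNNReal, fun f hf hsup x => ?_⟩
  rw [ENNReal.coe_toNNReal hKt]
  by_cases hx : x ∈ closedBall (0 : Ed d) 2
  swap
  · have : f x = 0 := by
      by_contra h
      exact hx (hsup (subset_tsupport _ h))
    simp [this]
  have hxn : ‖x‖ ≤ 2 := by simpa using hx
  set G : Ed d → ℝ≥0∞ := fun z => ‖fderiv ℝ f z‖ₑ with hG
  have cG : Continuous (fderiv ℝ f) := hf.continuous_fderiv (by simp)
  have hc : HasCompactSupport f :=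
    (isCompact_closedBall (0 : Ed d) 2).of_isClosed_subset (isClosed_tsupport _) hsup
  have hGsup : ∀ z, 2 < ‖z‖ → G z = 0 := by
    intro z hz
    have : z ∉ tsupport f := fun h => by
      have := hsup h
      simp at this; linarith
    have : fderiv ℝ f z = 0 := by
      by_contra h
      exact this (tsupport_fderiv_subset ℝ (subset_tsupport _ h))
    show ‖fderiv ℝ f z‖ₑ = 0
    rw [← ofReal_norm, this, norm_zero, ENNReal.ofReal_zero]
  -- line bound
  have hline : ∀ ω ∈ A, ‖f x‖ₑ ≤ 2 * ∫⁻ t in Ioc (-10 : ℝ) 0, G (x + t • ω) := by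
    intro ω hω
    have hω1 : ‖ω - e‖ < 1 / 2 := by simpa [hA, dist_eq_norm] using hω
    have hω2 : ‖ω‖ ≤ 2 := by
      have := norm_le_norm_add_norm_sub' ω e
      linarith
    have hω3 : 1 / 2 ≤ ‖ω‖ := by
      have := norm_le_norm_add_norm_sub' e ω
      rw [norm_sub_rev] at this
      linarith
    have hω0 : ω ≠ 0 := by
      intro h; rw [h, norm_zero] at hω3; norm_num at hω3
    have hd : ∀ t, HasDerivAt (fun t : ℝ => f (x + t • ω)) (fderiv ℝ f (x + t • ω) ω) t := by
      intro t
      have h2 : HasDerivAt (fun t : ℝ => x + t • ω) ω t := by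
        simpa using ((hasDerivAt_id t).smul_const ω).const_add x
      exact (sm_diff hf _).hasFDerivAt.comp_hasDerivAt t h2
    have e1 : ContDiff ℝ 1 (fun t : ℝ => f (x + t • ω)) :=
      (hf.of_le (by exact_mod_cast le_top)).comp
        (contDiff_const.add (contDiff_id.smul contDiff_const))
    have far : ∀ t : ℝ, 10 < |t| → 2 < ‖x + t • ω‖ := by
      intro t ht
      have h1 := norm_sub_le (x + t • ω) x
      rw [add_sub_cancel_left, norm_smul, Real.norm_eq_abs] at h1
      have : 10 * (1/2) < |t| * ‖ω‖ := by
        have := mul_le_mul_of_nonneg_left hω3 (abs_nonneg t)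
        linarith
      linarith
    have e2 : HasCompactSupport (fun t : ℝ => f (x + t • ω)) := by
      refine HasCompactSupport.of_support_subset_isCompact (isCompact_Icc (a := -10) (b := 10)) ?_
      intro t ht
      refine abs_le.1 ?_
      by_contra hcon
      push Not at hcon
      have h1 := far t hcon
      have h2 := hsup (subset_tsupport _ ht)
      simp at h2
      linarith
    have h3 := HasCompactSupport.enorm_le_lintegral_Ici_deriv e1 e2 0
    simp only [zero_smul, add_zero] at h3
    refine h3.trans ?_
    have h4 : ∫⁻ t in Iic (0 : ℝ), ‖deriv (fun t : ℝ => f (x + t • ω)) t‖ₑ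
        ≤ ∫⁻ t in Iic (0 : ℝ), (Ioc (-10 : ℝ) 0 ∪ Iic (-10)).indicator
            (fun t => 2 * G (x + t • ω)) t := by
      refine setLIntegral_mono' measurableSet_Iic fun t ht => ?_
      rw [indicator_of_mem]
      · rw [(hd t).deriv]
        refine (ContinuousLinearMap.le_opENorm _ _).trans ?_
        rw [mul_comm]
        gcongr
        rw [← ofReal_norm]
        simpa using ENNReal.ofReal_le_ofReal hω2
      · by_cases h : t ≤ -10
        · exact Or.inr h
        · exact Or.inl ⟨by linarith, ht⟩
    refine h4.trans ?_
    have h5 : (fun t => (Ioc (-10 : ℝ) 0 ∪ Iic (-10)).indicator (fun t => 2 * G (x + t • ω)) t)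
        =ᵐ[volume] (Ioc (-10 : ℝ) 0).indicator (fun t => 2 * G (x + t • ω)) := by
      have : ∀ᵐ t : ℝ, t ≠ -10 := by simp [ae_iff]
      filter_upwards [this] with t ht
      by_cases h : t ∈ Ioc (-10 : ℝ) 0
      · rw [indicator_of_mem h, indicator_of_mem (mem_union_left _ h)]
      · rw [indicator_of_notMem h]
        by_cases h' : t ≤ -10
        · rw [indicator_of_mem (mem_union_right _ (mem_Iic.2 h'))]
          rw [hGsup _ (far t ?_), mul_zero]
          have : t < -10 := lt_of_le_of_ne h' ht
          rw [abs_of_neg (by linarith)]; linarith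
        · rw [indicator_of_notMem]
          rintro (h1 | h1)
          · exact h h1
          · exact h' h1
    refine (lintegral_mono' Measure.restrict_le_self le_rfl).trans ?_
    rw [lintegral_congr_ae h5, lintegral_indicator measurableSet_Ioc, lintegral_const_mul]
    fun_prop
  -- average
  have hmeas : Measurable (fun q : Ed d × ℝ => G (x + q.2 • q.1)) := by
    have : Continuous (fun q : Ed d × ℝ => fderiv ℝ f (x + q.2 • q.1)) := by fun_prop
    exact this.enorm.measurable
  have h1 : volume A * ‖f x‖ₑ ≤ 2 * ∫⁻ t in Ioc (-10 : ℝ) 0, ∫⁻ ω in A, G (x + t • ω) := by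
    calc volume A * ‖f x‖ₑ = ∫⁻ ω in A, ‖f x‖ₑ := by simp [mul_comm]
      _ ≤ ∫⁻ ω in A, 2 * ∫⁻ t in Ioc (-10 : ℝ) 0, G (x + t • ω) :=
        setLIntegral_mono' measurableSet_ball hline
      _ = 2 * ∫⁻ ω in A, ∫⁻ t in Ioc (-10 : ℝ) 0, G (x + t • ω) := by
        rw [lintegral_const_mul]
        exact hmeas.lintegral_prod_right'
      _ = _ := by
        rw [lintegral_lintegral_swap hmeas.aemeasurable]
  have h2 : ∀ t ∈ Ioc (-10 : ℝ) 0, t ≠ 0 → ∫⁻ ω in A, G (x + t • ω) ≤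
      ENNReal.ofReal (|t| ^ (-((d : ℝ) / r))) *
        (eLpNorm (fderiv ℝ f) (ENNReal.ofReal r) volume * volume A ^ (1 - 1 / r)) := by
    intro t _ ht
    have c1 : Continuous (fun ω => fderiv ℝ f (x + t • ω)) := by fun_prop
    have h := eLpNorm_le_eLpNorm_mul_rpow_measure_univ (μ := volume.restrict A)
      (f := fun ω => fderiv ℝ f (x + t • ω)) (p := 1) (q := ENNReal.ofReal r)
      (by simpa using hr1) c1.aestronglyMeasurable
    rw [eLpNorm_one_eq_lintegral_enorm, Measure.restrict_apply_univ, ENNReal.toReal_one,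
      ENNReal.toReal_ofReal hr0.le, div_one] at h
    refine h.trans ?_
    rw [← mul_assoc, ← eLp_affine (fderiv ℝ f) x ht hr0]
    gcongr
    exact Measure.restrict_le_self
  have h3 : ∫⁻ t in Ioc (-10 : ℝ) 0, ∫⁻ ω in A, G (x + t • ω) ≤
      J * (eLpNorm (fderiv ℝ f) (ENNReal.ofReal r) volume * volume A ^ (1 - 1 / r)) := by
    rw [hJ, ← lintegral_mul_const _ (by fun_prop)]
    refine lintegral_mono_ae ?_
    have : ∀ᵐ t : ℝ ∂(volume.restrict (Ioc (-10 : ℝ) 0)), t ≠ 0 :=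
      ae_restrict_of_ae (by simp [ae_iff])
    filter_upwards [this, ae_restrict_mem measurableSet_Ioc] with t ht0 ht
    exact h2 t ht ht0
  have h4 : ‖f x‖ₑ = (volume A)⁻¹ * (volume A * ‖f x‖ₑ) := by
    rw [← mul_assoc, ENNReal.inv_mul_cancel hA0 hA1, one_mul]
  rw [h4]
  calc (volume A)⁻¹ * (volume A * ‖f x‖ₑ)
      ≤ (volume A)⁻¹ * (2 * (J * (eLpNorm (fderiv ℝ f) (ENNReal.ofReal r) volume *
          volume A ^ (1 - 1 / r)))) := mul_le_mul_right (h1.trans (mul_le_mul_right h3 _)) _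
    _ = K * eLpNorm (fderiv ℝ f) (ENNReal.ofReal r) volume := by rw [hK]; ring

/-- Sobolev norm of a smooth function. -/
def Wn (d m : ℕ) (p : ℝ≥0∞) (μ : Measure (Ed d)) (f : Ed d → ℝ) : ℝ≥0∞ :=
  ∑ α ∈ multiIdx d m, eLpNorm (pderivA d α f) p μ

lemma le_Wn {d m : ℕ} {p : ℝ≥0∞} {μ : Measure (Ed d)} {f : Ed d → ℝ} {α : Fin d → ℕ}
    (h : ord α ≤ m) : eLpNorm (pderivA d α f) p μ ≤ Wn d m p μ f :=
  Finset.single_le_sum (f := fun α => eLpNorm (pderivA d α f) p μ) (fun _ _ => zero_le)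
    (mem_multiIdx.2 h)

lemma Wn_pderivA_le {d m n : ℕ} {p : ℝ≥0∞} {μ : Measure (Ed d)} {f : Ed d → ℝ} (hf : Sm f)
    {β : Fin d → ℕ} (h : ord β + n ≤ m) :
    Wn d n p μ (pderivA d β f) ≤ (multiIdx d n).card * Wn d m p μ f := by
  rw [← nsmul_eq_mul]
  refine Finset.sum_le_card_nsmul _ _ _ fun α hα => ?_
  rw [pderivA_add _ _ hf]
  apply le_Wn
  rw [ord_add]
  have := mem_multiIdx.1 hα
  omega

lemma norm_fderiv_le {d : ℕ} (f : Ed d → ℝ) (x : Ed d) :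
    ‖fderiv ℝ f x‖ ≤ ∑ i, ‖pderivI d i f x‖ := by
  refine ContinuousLinearMap.opNorm_le_bound _ (by positivity) fun v => ?_
  have hv : v = ∑ i, v i • (EuclideanSpace.single i (1 : ℝ) : Ed d) := by
    ext j
    simp [Finset.sum_apply, Pi.single_apply]
  conv_lhs => rw [hv, map_sum]
  refine (norm_sum_le _ _).trans ?_
  rw [Finset.sum_mul]
  refine Finset.sum_le_sum fun i _ => ?_
  rw [map_smul, norm_smul, mul_comm]
  exact mul_le_mul_of_nonneg_left (PiLp.norm_apply_le v i) (norm_nonneg _)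

lemma eLp_fderiv_le {d : ℕ} {f : Ed d → ℝ} (hf : Sm f) {r : ℝ≥0∞} (hr : 1 ≤ r)
    (μ : Measure (Ed d)) :
    eLpNorm (fderiv ℝ f) r μ ≤ ∑ i, eLpNorm (pderivI d i f) r μ := by
  calc eLpNorm (fderiv ℝ f) r μ ≤ eLpNorm (∑ i, fun x => ‖pderivI d i f x‖) r μ := by
        refine eLpNorm_mono_real fun x => ?_
        rw [Finset.sum_apply]
        exact norm_fderiv_le f x
    _ ≤ ∑ i, eLpNorm (fun x => ‖pderivI d i f x‖) r μ :=
        eLpNorm_sum_le (fun i _ => (sm_pderivI i hf).continuous.norm.aestronglyMeasurable) hr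
    _ = _ := by simp only [eLpNorm_norm]

lemma gns {d : ℕ} (hd : 2 ≤ d) (i : ℕ) {p : ℝ} (hp : 1 ≤ p) : ∀ q : ℝ, 0 < q →
    p⁻¹ - i / d ≤ q⁻¹ → ∃ C : ℝ≥0, ∀ f : Ed d → ℝ, Sm f → tsupport f ⊆ closedBall 0 2 →
      eLpNorm f (ENNReal.ofReal q) volume ≤ C * Wn d i (ENNReal.ofReal p) volume f := by
  have hp0 : 0 < p := by linarith
  have hd0 : (2 : ℝ) ≤ d := by exact_mod_cast hd
  have hdpos : (0 : ℝ) < d := by linarith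
  induction i with
  | zero =>
    intro q hq h
    simp only [Nat.cast_zero, zero_div, sub_zero] at h
    have hqp : q ≤ p := (inv_le_inv₀ hp0 hq).1 h
    set B := closedBall (0 : Ed d) 2
    set K : ℝ≥0∞ := (volume B) ^ (1 / q - 1 / p) with hK
    have hKt : K ≠ ⊤ := by
      refine ENNReal.rpow_ne_top_of_nonneg ?_ (isCompact_closedBall _ _).measure_lt_top.ne
      rw [one_div, one_div]; linarith
    refine ⟨K.toNNReal, fun f hf hs => ?_⟩
    rw [ENNReal.coe_toNNReal hKt]
    have hs' : Function.support f ⊆ B := (subset_tsupport f).trans hs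
    have h1 := eLpNorm_le_eLpNorm_mul_rpow_measure_univ (μ := volume.restrict B) (f := f)
      (ENNReal.ofReal_le_ofReal hqp) hf.continuous.aestronglyMeasurable
    rw [eLpNorm_restrict_eq_of_support_subset hs', eLpNorm_restrict_eq_of_support_subset hs',
      ENNReal.toReal_ofReal hq.le, ENNReal.toReal_ofReal hp0.le, Measure.restrict_apply_univ,
      mul_comm] at h1
    refine h1.trans ?_
    gcongr
    have := le_Wn (d := d) (m := 0) (p := ENNReal.ofReal p) (μ := volume) (f := f) (α := 0)
      (by simp [ord])
    rwa [pderivA_zero] at this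
  | succ i ih =>
    intro q hq h
    have hq' : 0 < q⁻¹ := by positivity
    set r : ℝ := (min 1 (q⁻¹ + 1 / d))⁻¹ with hr
    have hmin : 0 < min 1 (q⁻¹ + 1 / d) := by positivity
    have hri : r⁻¹ = min 1 (q⁻¹ + 1 / d) := by rw [hr, inv_inv]
    have hr0 : 0 < r := by positivity
    have hr1 : 1 ≤ r := by
      rw [hr]; exact (one_le_inv₀ hmin).2 (min_le_left _ _)
    have hrd : r < d := by
      rw [hr]
      refine inv_lt_of_inv_lt₀ hdpos ?_
      rw [lt_min_iff]
      refine ⟨inv_lt_one_of_one_lt₀ (by linarith), ?_⟩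
      rw [one_div]; linarith
    have hpi : p⁻¹ ≤ 1 := inv_le_one_of_one_le₀ hp
    obtain ⟨C2, hC2⟩ := ih r hr0 (by
      rw [hri, le_min_iff]
      push_cast at h
      rw [add_div] at h
      have : (0 : ℝ) ≤ i / d := by positivity
      constructor <;> linarith)
    set C1 := eLpNormLESNormFDerivOfLeConst ℝ (volume : Measure (Ed d)) (closedBall 0 2)
      r.toNNReal q.toNNReal with hC1
    refine ⟨C1 * (d * (C2 * (multiIdx d i).card)), fun f hf hs => ?_⟩
    have h1 := eLpNorm_le_eLpNorm_fderiv_of_le (F := ℝ) (volume : Measure (Ed d)) (u := f)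
      (s := closedBall 0 2) (p := r.toNNReal) (q := q.toNNReal)
      (hf.of_le (by exact_mod_cast le_top)) ((subset_tsupport f).trans hs)
      (by rw [Real.one_le_toNNReal]; exact hr1)
      (by
        rw [finrank_euclideanSpace_fin]
        rw [← NNReal.coe_lt_coe, Real.coe_toNNReal _ hr0.le]
        exact_mod_cast hrd)
      (by
        rw [finrank_euclideanSpace_fin, Real.coe_toNNReal _ hq.le, NNReal.coe_inv,
          Real.coe_toNNReal _ hr0.le, hri]
        have := min_le_right 1 (q⁻¹ + 1 / (d : ℝ))
        rw [one_div] at this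
        rw [one_div]
        linarith) isBounded_closedBall
    refine h1.trans ?_
    rw [ENNReal.coe_mul, mul_assoc]
    refine mul_le_mul_right ?_ _
    have hr1' : 1 ≤ ((r.toNNReal : ℝ≥0) : ℝ≥0∞) := by
      rw [ENNReal.one_le_coe_iff, Real.one_le_toNNReal]; exact hr1
    refine (eLp_fderiv_le hf hr1' volume).trans ?_
    have : ∀ j ∈ (Finset.univ : Finset (Fin d)), eLpNorm (pderivI d j f) (ENNReal.ofReal r) volume
        ≤ (C2 * (multiIdx d i).card) * Wn d (i + 1) (ENNReal.ofReal p) volume f := by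
      intro j _
      have h2 := hC2 _ (sm_pderivI j hf) ((pderivI_tsupport j f).trans hs)
      refine h2.trans ?_
      rw [mul_assoc]
      gcongr
      rw [← pderivA_eI j hf]
      exact Wn_pderivA_le hf (by rw [ord_eI]; omega)
    refine (Finset.sum_le_card_nsmul _ _ _ this).trans ?_
    simp only [Finset.card_univ, Fintype.card_fin, nsmul_eq_mul]
    push_cast
    exact le_of_eq (by ring)

/-- The algebra condition on parameters. -/
def AlgCond (d m : ℕ) (p : ℝ) : Prop := (1 < p ∧ (d : ℝ) / p < m) ∨ (p = 1 ∧ d ≤ m)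

lemma sob_top {d m : ℕ} (hd : 2 ≤ d) (hm : 1 ≤ m) {p : ℝ} (hp : 1 ≤ p) (H : AlgCond d m p) :
    ∃ C : ℝ≥0, ∀ f : Ed d → ℝ, Sm f → tsupport f ⊆ closedBall 0 2 →
      ∀ x, ‖f x‖ₑ ≤ C * Wn d m (ENNReal.ofReal p) volume f := by
  have hd0 : (2 : ℝ) ≤ d := by exact_mod_cast hd
  have hdpos : (0 : ℝ) < d := by linarith
  have hp0 : 0 < p := by linarith
  rcases H with ⟨h1, h2⟩ | ⟨rfl, h2⟩
  · set s : ℝ := max (p⁻¹ - (m - 1 : ℕ) / d) (1 / (2 * d)) with hs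
    have hs0 : 0 < s := lt_max_of_lt_right (by positivity)
    have hsd : s < 1 / d := by
      rw [hs, max_lt_iff]
      constructor
      · rw [Nat.cast_sub hm, Nat.cast_one]
        rw [div_lt_iff₀ hp0] at h2
        have : p⁻¹ < m / d := by
          rw [inv_lt_iff_one_lt_mul₀ hp0, div_mul_eq_mul_div, lt_div_iff₀ hdpos]
          linarith
        rw [sub_div]; linarith
      · apply one_div_lt_one_div_of_lt hdpos; linarith
    have hrd : (d : ℝ) < s⁻¹ := by
      rw [lt_inv_comm₀ hdpos hs0, ← one_div]; exact hsd
    obtain ⟨C1, hC1⟩ := morrey hd hrd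
    obtain ⟨C2, hC2⟩ := gns hd (m - 1) hp s⁻¹ (by positivity) (by
      rw [inv_inv]; exact le_max_left _ _)
    refine ⟨C1 * (d * (C2 * (multiIdx d (m - 1)).card)), fun f hf hsup x => ?_⟩
    refine (hC1 f hf hsup x).trans ?_
    rw [ENNReal.coe_mul, mul_assoc]
    refine mul_le_mul_right ?_ _
    refine (eLp_fderiv_le hf (by
      rw [ENNReal.one_le_ofReal]; linarith) volume).trans ?_
    have : ∀ j ∈ (Finset.univ : Finset (Fin d)), eLpNorm (pderivI d j f) (ENNReal.ofReal s⁻¹) volume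
        ≤ (C2 * (multiIdx d (m - 1)).card) * Wn d m (ENNReal.ofReal p) volume f := by
      intro j _
      have h2 := hC2 _ (sm_pderivI j hf) ((pderivI_tsupport j f).trans hsup)
      refine h2.trans ?_
      rw [mul_assoc]
      gcongr
      rw [← pderivA_eI j hf]
      exact Wn_pderivA_le hf (by rw [ord_eI]; omega)
    refine (Finset.sum_le_card_nsmul _ _ _ this).trans ?_
    simp only [Finset.card_univ, Fintype.card_fin, nsmul_eq_mul]
    push_cast
    exact le_of_eq (by ring)
  · refine ⟨1, fun f hf hsup x => ?_⟩
    rw [ENNReal.coe_one, one_mul, ENNReal.ofReal_one]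
    refine (sup_le_L1 hf ((isCompact_closedBall (0 : Ed d) 2).of_isClosed_subset
      (isClosed_tsupport _) hsup) x).trans ?_
    apply le_Wn
    simpa [ord] using h2

/-- Interpolation exponents. -/
def Qe (m : ℕ) (p : ℝ) (k : ℕ) : ℝ≥0∞ := (ENNReal.ofReal (k / (m * p)))⁻¹

lemma sob {d m : ℕ} (hd : 2 ≤ d) (hm : 1 ≤ m) {p : ℝ} (hp : 1 ≤ p) (H : AlgCond d m p)
    (k : ℕ) (hk : k ≤ m) :
    ∃ C : ℝ≥0, ∀ f : Ed d → ℝ, Sm f → tsupport f ⊆ closedBall 0 2 → ∀ β, ord β ≤ k →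
      eLpNorm (pderivA d β f) (Qe m p k) volume ≤ C * Wn d m (ENNReal.ofReal p) volume f := by
  have hd0 : (2 : ℝ) ≤ d := by exact_mod_cast hd
  have hdpos : (0 : ℝ) < d := by linarith
  have hp0 : 0 < p := by linarith
  have hm0 : (0 : ℝ) < m := by exact_mod_cast hm
  have hdm : (d : ℝ) ≤ m * p := by
    rcases H with ⟨h1, h2⟩ | ⟨rfl, h2⟩
    · rw [div_lt_iff₀ hp0] at h2; exact h2.le
    · rw [mul_one]; exact_mod_cast h2
  rcases Nat.eq_zero_or_pos k with rfl | hk0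
  · obtain ⟨C, hC⟩ := sob_top hd hm hp H
    refine ⟨C, fun f hf hsup β hβ => ?_⟩
    have hβ0 : β = 0 := by
      funext i
      have := Finset.single_le_sum (f := β) (fun i _ => Nat.zero_le _) (Finset.mem_univ i)
      simp only [ord] at hβ
      simp only [Pi.zero_apply]
      omega
    rw [hβ0, pderivA_zero]
    simp only [Qe, Nat.cast_zero, zero_div, ENNReal.ofReal_zero, ENNReal.inv_zero,
      eLpNorm_exponent_top]
    exact eLpNormEssSup_le_of_ae_enorm_bound (ae_of_all _ (hC f hf hsup))
  · have hk' : (0 : ℝ) < k := by exact_mod_cast hk0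
    have hq : 0 < (k : ℝ) / (m * p) := by positivity
    obtain ⟨C, hC⟩ := gns hd (m - k) hp (((k : ℝ) / (m * p))⁻¹) (by positivity) (by
      rw [inv_inv, Nat.cast_sub hk]
      have h1 : ((m : ℝ) - k) / (m * p) ≤ (m - k) / d := by
        have : (k : ℝ) ≤ m := by exact_mod_cast hk
        exact div_le_div_of_nonneg_left (by linarith) hdpos hdm
      have h2 : ((m : ℝ) - k) / (m * p) = p⁻¹ - k / (m * p) := by
        field_simp
      linarith)
    refine ⟨C * (multiIdx d (m - k)).card, fun f hf hsup β hβ => ?_⟩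
    have h1 := hC _ (sm_pderivA β hf) ((pderivA_tsupport β hf).trans hsup)
    rw [ENNReal.ofReal_inv_of_pos hq] at h1
    refine h1.trans ?_
    push_cast
    rw [mul_assoc]
    gcongr
    exact Wn_pderivA_le hf (by omega)

lemma Qe_holder {m k : ℕ} (hm : 1 ≤ m) (hk : k ≤ m) {p : ℝ} (hp : 1 ≤ p) :
    ENNReal.HolderTriple (Qe m p k) (Qe m p (m - k)) (ENNReal.ofReal p) := by
  have hp0 : 0 < p := by linarith
  have hm0 : (0 : ℝ) < m := by exact_mod_cast hm
  constructor
  rw [Qe, Qe, inv_inv, inv_inv, ← ENNReal.ofReal_add (by positivity) (by positivity),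
    ← ENNReal.ofReal_inv_of_pos hp0, Nat.cast_sub hk]
  congr 1
  field_simp
  ring

lemma prod_cs {d m : ℕ} (hd : 2 ≤ d) (hm : 1 ≤ m) {p : ℝ} (hp : 1 ≤ p) (H : AlgCond d m p) :
    ∃ C : ℝ≥0, ∀ f g : Ed d → ℝ, Sm f → Sm g → tsupport f ⊆ closedBall 0 2 →
      tsupport g ⊆ closedBall 0 2 → ∀ β δ, ord β + ord δ ≤ m →
      eLpNorm (pderivA d β f * pderivA d δ g) (ENNReal.ofReal p) volume ≤
        C * (Wn d m (ENNReal.ofReal p) volume f * Wn d m (ENNReal.ofReal p) volume g) := by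
  choose! C hC using fun (k : ℕ) (hk : k ≤ m) => sob hd hm hp H k hk
  refine ⟨∑ k ∈ Finset.range (m + 1), C k * C (m - k), fun f g hf hg hsf hsg β δ h => ?_⟩
  set k := ord β with hk
  have hkm : k ≤ m := by omega
  have := Qe_holder hm hkm hp
  have h1 : eLpNorm (pderivA d β f * pderivA d δ g) (ENNReal.ofReal p) volume ≤
      eLpNorm (pderivA d β f) (Qe m p k) volume * eLpNorm (pderivA d δ g) (Qe m p (m - k)) volume :=
    eLpNorm_smul_le_mul_eLpNorm (φ := pderivA d β f) (f := pderivA d δ g)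
      (sm_pderivA _ hg).continuous.aestronglyMeasurable
      (sm_pderivA _ hf).continuous.aestronglyMeasurable
  refine h1.trans ((mul_le_mul' (hC k hkm f hf hsf β le_rfl)
    (hC (m - k) (by omega) g hg hsg δ (by omega))).trans ?_)
  have h2 : C k * C (m - k) ≤ ∑ k ∈ Finset.range (m + 1), C k * C (m - k) :=
    Finset.single_le_sum (f := fun k => C k * C (m - k)) (fun _ _ => zero_le)
      (Finset.mem_range.2 (by omega))
  calc _ = ((C k * C (m - k) : ℝ≥0) : ℝ≥0∞) * (Wn d m (ENNReal.ofReal p) volume f *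
        Wn d m (ENNReal.ofReal p) volume g) := by push_cast; ring
    _ ≤ _ := by gcongr

lemma eLp_lsum_le {d : ℕ} (L : List ((Fin d → ℕ) × (Fin d → ℕ))) (D E : (Fin d → ℕ) → Ed d → ℝ)
    {p : ℝ≥0∞} (hp : 1 ≤ p) (μ : Measure (Ed d)) (B : ℝ≥0∞)
    (hm : ∀ q ∈ L, AEStronglyMeasurable (D q.1 * E q.2) μ)
    (hB : ∀ q ∈ L, eLpNorm (D q.1 * E q.2) p μ ≤ B) :
    AEStronglyMeasurable (lsum L D E) μ ∧ eLpNorm (lsum L D E) p μ ≤ L.length * B := by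
  induction L with
  | nil =>
    have : lsum [] D E = 0 := rfl
    rw [this]
    exact ⟨aestronglyMeasurable_zero, by simp⟩
  | cons q L ih =>
    have e : lsum (q :: L) D E = D q.1 * E q.2 + lsum L D E := rfl
    obtain ⟨h1, h2⟩ := ih (fun q hq => hm q (List.mem_cons_of_mem _ hq))
      (fun q hq => hB q (List.mem_cons_of_mem _ hq))
    have h3 := hm q List.mem_cons_self
    rw [e]
    refine ⟨h3.add h1, (eLpNorm_add_le h3 h1 hp).trans ?_⟩
    rw [List.length_cons]
    push_cast
    rw [add_mul, one_mul, add_comm]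
    exact add_le_add h2 (hB q List.mem_cons_self)

lemma cutoff {d : ℕ} (m : ℕ) {p : ℝ} (hp : 1 ≤ p) {η : Ed d → ℝ} (hη : Sm η)
    (hs : tsupport η ⊆ closedBall 0 2) : ∃ C : ℝ≥0, ∀ f : Ed d → ℝ, Sm f →
      Wn d m (ENNReal.ofReal p) volume (η * f) ≤
        C * Wn d m (ENNReal.ofReal p) (volume.restrict (closedBall 0 2)) f := by
  have hc : HasCompactSupport η :=
    (isCompact_closedBall (0 : Ed d) 2).of_isClosed_subset (isClosed_tsupport _) hs
  have hbd : ∀ α : Fin d → ℕ, ∃ M : ℝ≥0, ∀ x, ‖pderivA d α η x‖₊ ≤ M := by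
    intro α
    obtain ⟨M, hM⟩ := (sm_pderivA α hη).continuous.bounded_above_of_compact_support
      (hc.of_isClosed_subset (isClosed_tsupport _) (pderivA_tsupport α hη))
    exact ⟨M.toNNReal, fun x => by
      rw [← NNReal.coe_le_coe, coe_nnnorm]; exact (hM x).trans (Real.le_coe_toNNReal M)⟩
  choose M hM using hbd
  choose L hL hLs using fun α : Fin d → ℕ => leibniz α
  set MM : ℝ≥0 := ∑ α ∈ multiIdx d m, M α
  refine ⟨∑ α ∈ multiIdx d m, (L α).length * MM, fun f hf => ?_⟩
  rw [ENNReal.ofNNReal_finsetSum, Finset.sum_mul, Wn]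
  refine Finset.sum_le_sum fun α hα => ?_
  have hsm : Sm (η * f) := sm_mul hη hf
  have hsup : Function.support (pderivA d α (η * f)) ⊆ closedBall 0 2 := by
    refine (subset_tsupport _).trans ((pderivA_tsupport α hsm).trans ?_)
    exact (tsupport_mul_subset_left).trans hs
  rw [← eLpNorm_restrict_eq_of_support_subset hsup, hLs α η f hη hf]
  push_cast
  rw [mul_assoc]
  refine (eLp_lsum_le _ _ _ (by simpa using hp) _ _ ?_ ?_).2
  · intro q _
    exact ((sm_pderivA _ hη).continuous.mul (sm_pderivA _ hf).continuous).aestronglyMeasurable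
  · intro q hq
    have hqo := hL α q hq
    have hαo := mem_multiIdx.1 hα
    have h1 : eLpNorm (pderivA d q.1 η * pderivA d q.2 f) (ENNReal.ofReal p)
        (volume.restrict (closedBall 0 2)) ≤
        M q.1 • eLpNorm (pderivA d q.2 f) (ENNReal.ofReal p)
          (volume.restrict (closedBall 0 2)) := by
      refine eLpNorm_le_nnreal_smul_eLpNorm_of_ae_le_mul (ae_of_all _ fun x => ?_) _
      rw [Pi.mul_apply, nnnorm_mul]
      exact mul_le_mul_left (hM q.1 x) _
    refine h1.trans ?_
    rw [ENNReal.smul_def, smul_eq_mul]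
    refine mul_le_mul' ?_ (le_Wn (by omega))
    have : M q.1 ≤ MM := Finset.single_le_sum (f := M) (fun _ _ => zero_le)
      (mem_multiIdx.2 (by omega))
    exact_mod_cast this

lemma prod_unit {d m : ℕ} (hd : 2 ≤ d) (hm : 1 ≤ m) {p : ℝ} (hp : 1 ≤ p) (H : AlgCond d m p) :
    ∃ C : ℝ≥0, ∀ f g : Ed d → ℝ, Sm f → Sm g → ∀ β δ, ord β + ord δ ≤ m →
      eLpNorm (pderivA d β f * pderivA d δ g) (ENNReal.ofReal p) (volume.restrict (ball 0 1)) ≤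
        C * (Wn d m (ENNReal.ofReal p) (volume.restrict (closedBall 0 2)) f *
          Wn d m (ENNReal.ofReal p) (volume.restrict (closedBall 0 2)) g) := by
  let η : ContDiffBump (0 : Ed d) := ⟨1, 2, by norm_num, by norm_num⟩
  have hη : Sm (η : Ed d → ℝ) := η.contDiff
  have hs : tsupport (η : Ed d → ℝ) ⊆ closedBall 0 2 := η.tsupport_eq.le
  obtain ⟨C1, hC1⟩ := prod_cs hd hm hp H
  obtain ⟨C2, hC2⟩ := cutoff m hp hη hs
  refine ⟨C1 * (C2 * C2), fun f g hf hg β δ h => ?_⟩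
  have e : ∀ f : Ed d → ℝ, EqOn ((η : Ed d → ℝ) * f) f (ball 0 1) := by
    intro f x hx
    have : η x = 1 := η.one_of_mem_closedBall (ball_subset_closedBall hx)
    simp [this]
  have h1 := hC1 _ _ (sm_mul hη hf) (sm_mul hη hg) (tsupport_mul_subset_left.trans hs)
    (tsupport_mul_subset_left.trans hs) β δ h
  calc _ = eLpNorm (pderivA d β (η * f) * pderivA d δ (η * g)) (ENNReal.ofReal p)
          (volume.restrict (ball 0 1)) := by
        refine eLpNorm_congr_ae ?_
        filter_upwards [ae_restrict_mem measurableSet_ball] with x hx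
        rw [Pi.mul_apply, Pi.mul_apply, pderivA_eqOn β (sm_mul hη hf) hf isOpen_ball (e f) hx,
          pderivA_eqOn δ (sm_mul hη hg) hg isOpen_ball (e g) hx]
    _ ≤ _ := eLpNorm_mono_measure _ Measure.restrict_le_self
    _ ≤ _ := h1
    _ ≤ C1 * ((C2 * Wn d m (ENNReal.ofReal p) (volume.restrict (closedBall 0 2)) f) *
          (C2 * Wn d m (ENNReal.ofReal p) (volume.restrict (closedBall 0 2)) g)) := by
        gcongr
        · exact hC2 f hf
        · exact hC2 g hg
    _ = _ := by push_cast; ring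

/-- Scaled Sobolev norm of a family. -/
def Wr (d m : ℕ) (p : ℝ) (y : Ed d) (r : ℝ) (D : (Fin d → ℕ) → Ed d → ℝ) : ℝ≥0∞ :=
  ∑ α ∈ multiIdx d m, ENNReal.ofReal (r ^ ord α) *
    eLpNorm (D α) (ENNReal.ofReal p) (volume.restrict (closedBall y (2 * r)))

lemma eLp_affine_restrict {d : ℕ} (h : Ed d → ℝ) (y : Ed d) {r p : ℝ}
    (hr : 0 < r) (hp : 0 < p) (s t : Set (Ed d)) (hs : MeasurableSet s) (ht : MeasurableSet t)
    (hst : ∀ z, z ∈ s ↔ y + r • z ∈ t) :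
    eLpNorm (fun z => h (y + r • z)) (ENNReal.ofReal p) (volume.restrict s)
      = ENNReal.ofReal (r ^ (-((d : ℝ) / p))) * eLpNorm h (ENNReal.ofReal p) (volume.restrict t) := by
  rw [← eLpNorm_indicator_eq_eLpNorm_restrict hs, ← eLpNorm_indicator_eq_eLpNorm_restrict ht]
  have := eLp_affine (t.indicator h) y hr.ne' hp
  rw [abs_of_pos hr] at this
  rw [← this]
  congr 1
  funext z
  by_cases hz : z ∈ s
  · rw [indicator_of_mem hz, indicator_of_mem ((hst z).1 hz)]
  · rw [indicator_of_notMem hz, indicator_of_notMem (fun h' => hz ((hst z).2 h'))]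

lemma prod_scaled {d m : ℕ} (hd : 2 ≤ d) (hm : 1 ≤ m) {p : ℝ} (hp : 1 ≤ p) (H : AlgCond d m p) :
    ∃ C : ℝ≥0, ∀ f g : Ed d → ℝ, Sm f → Sm g → ∀ β δ, ord β + ord δ ≤ m →
      ∀ (y : Ed d) (r : ℝ), 0 < r →
      ENNReal.ofReal (r ^ (ord β + ord δ)) *
      eLpNorm (pderivA d β f * pderivA d δ g) (ENNReal.ofReal p) (volume.restrict (ball y r)) ≤
        C * ENNReal.ofReal (r ^ (-((d : ℝ) / p))) *
          (Wr d m p y r (fun α => pderivA d α f) * Wr d m p y r (fun α => pderivA d α g)) := by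
  obtain ⟨C, hC⟩ := prod_unit hd hm hp H
  refine ⟨C, fun f g hf hg β δ h y r hr => ?_⟩
  have hp0 : 0 < p := by linarith
  have sm : ∀ g : Ed d → ℝ, Sm g → Sm (fun z => g (y + r • z)) := fun g hg =>
    hg.comp (contDiff_const.add (contDiff_id.const_smul r))
  have hb : ∀ z : Ed d, z ∈ ball (0 : Ed d) 1 ↔ y + r • z ∈ ball y r := by
    intro z
    simp [norm_smul, abs_of_pos hr, hr]
  have hcb : ∀ z : Ed d, z ∈ closedBall (0 : Ed d) 2 ↔ y + r • z ∈ closedBall y (2 * r) := by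
    intro z
    simp [norm_smul, abs_of_pos hr]
    rw [mul_comm 2 r, mul_le_mul_iff_right₀ hr]
  set κ := ENNReal.ofReal (r ^ (-((d : ℝ) / p))) with hκ
  have hκ0 : κ ≠ 0 := by
    rw [hκ]; simp; positivity
  have hκt : κ ≠ ⊤ := ENNReal.ofReal_ne_top
  have hW : ∀ f : Ed d → ℝ, Sm f → Wn d m (ENNReal.ofReal p) (volume.restrict (closedBall 0 2))
      (fun z => f (y + r • z)) = κ * Wr d m p y r (fun α => pderivA d α f) := by
    intro f hf
    rw [Wn, Wr, Finset.mul_sum]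
    refine Finset.sum_congr rfl fun α _ => ?_
    rw [pderivA_affine α hf]
    have : (fun z => r ^ ord α * pderivA d α f (y + r • z))
      = (r ^ ord α) • fun z => pderivA d α f (y + r • z) := rfl
    rw [this, eLpNorm_const_smul, eLp_affine_restrict _ y hr hp0 _ _ measurableSet_closedBall
      measurableSet_closedBall hcb, Real.enorm_eq_ofReal (by positivity)]
    ring
  have h1 := hC _ _ (sm f hf) (sm g hg) β δ h
  rw [hW f hf, hW g hg, pderivA_affine β hf, pderivA_affine δ hg] at h1
  have e : ((fun z => r ^ ord β * pderivA d β f (y + r • z)) *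
      (fun z => r ^ ord δ * pderivA d δ g (y + r • z)))
      = (r ^ (ord β + ord δ)) • fun z => (pderivA d β f * pderivA d δ g) (y + r • z) := by
    funext z
    simp only [Pi.mul_apply, Pi.smul_apply, smul_eq_mul]
    ring
  rw [e, eLpNorm_const_smul, eLp_affine_restrict _ y hr hp0 _ _ measurableSet_ball
      measurableSet_ball hb, Real.enorm_eq_ofReal (by positivity)] at h1
  rw [← ENNReal.mul_le_mul_iff_right hκ0 hκt]
  calc _ = _ := by rw [mul_left_comm]
    _ ≤ _ := h1
    _ = _ := by ring

/-- Convolution of two real functions. -/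
def cv {d : ℕ} (κ f : Ed d → ℝ) : Ed d → ℝ :=
  MeasureTheory.convolution κ f (ContinuousLinearMap.mul ℝ ℝ) volume

lemma cv_apply {d : ℕ} (κ f : Ed d → ℝ) (x : Ed d) : cv κ f x = ∫ t, κ t * f (x - t) := rfl

lemma cv_swap {d : ℕ} (κ f : Ed d → ℝ) (x : Ed d) : cv κ f x = ∫ y, κ (x - y) * f y :=
  convolution_mul_swap

lemma cv_sm {d : ℕ} {κ f : Ed d → ℝ} (hκ : Sm κ) (hc : HasCompactSupport κ)
    (hf : LocallyIntegrable f volume) : Sm (cv κ f) :=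
  hc.contDiff_convolution_left _ hκ hf

lemma cv_pderivI {d : ℕ} {κ f : Ed d → ℝ} (hκ : Sm κ) (hc : HasCompactSupport κ)
    (hf : LocallyIntegrable f volume) (i : Fin d) : pderivI d i (cv κ f) = cv (pderivI d i κ) f := by
  funext x
  have hκ1 : ContDiff ℝ 1 κ := hκ.of_le (by exact_mod_cast le_top)
  have h := hc.hasFDerivAt_convolution_left (ContinuousLinearMap.mul ℝ ℝ) hκ1 hf x
  rw [pderivI]
  unfold cv
  rw [h.fderiv]
  have hint := (hc.fderiv (𝕜 := ℝ)).convolutionExists_left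
    ((ContinuousLinearMap.mul ℝ ℝ).precompL (Ed d)) (hκ1.continuous_fderiv one_ne_zero) hf x
  rw [convolution_def, ContinuousLinearMap.integral_apply hint]
  rfl

lemma cs_pderivA {d : ℕ} {κ : Ed d → ℝ} (hκ : Sm κ) (hc : HasCompactSupport κ) (α : Fin d → ℕ) :
    HasCompactSupport (pderivA d α κ) :=
  hc.of_isClosed_subset (isClosed_tsupport _) (pderivA_tsupport α hκ)

lemma cv_pderivA {d : ℕ} {κ f : Ed d → ℝ} (hκ : Sm κ) (hc : HasCompactSupport κ)
    (hf : LocallyIntegrable f volume) (α : Fin d → ℕ) :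
    pderivA d α (cv κ f) = cv (pderivA d α κ) f := by
  induction α using multi_induction with
  | h0 => rw [pderivA_zero, pderivA_zero]
  | hs α i ih =>
    rw [pderivA_succ _ _ (cv_sm hκ hc hf), ih, pderivA_succ _ _ hκ,
      cv_pderivI (sm_pderivA α hκ) (cs_pderivA hκ hc α) hf]

lemma cv_weak {d : ℕ} {Ω S : Set (Ed d)} {α : Fin d → ℕ} {u v : Ed d → ℝ}
    (h : HasWeakDerivOn d Ω α u v) (hS : MeasurableSet S) (hSΩ : S ⊆ Ω) (hΩ : MeasurableSet Ω)
    {κ : Ed d → ℝ} (hκ : Sm κ)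
    {δ : ℝ} (hs : tsupport κ ⊆ closedBall 0 δ) (x : Ed d) (hx : closedBall x δ ⊆ S) :
    cv (pderivA d α κ) (S.indicator u) x = cv κ (S.indicator v) x := by
  have hc : HasCompactSupport κ :=
    (isCompact_closedBall (0 : Ed d) δ).of_isClosed_subset (isClosed_tsupport _) hs
  set φ : Ed d → ℝ := fun y => κ (x + (-1 : ℝ) • y) with hφ
  have hφs : Sm φ := hκ.comp (contDiff_const.add (contDiff_id.const_smul (-1 : ℝ)))
  have hsup : tsupport φ ⊆ closedBall x δ := by
    refine closure_minimal ?_ isClosed_closedBall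
    intro y hy
    have : x + (-1 : ℝ) • y ∈ closedBall (0 : Ed d) δ := hs (subset_tsupport _ hy)
    rw [mem_closedBall, dist_zero_right] at this
    rw [mem_closedBall, dist_comm, dist_eq_norm]
    simpa [sub_eq_add_neg] using this
  have ht : IsTestFun d Ω φ := ⟨hφs,
    (isCompact_closedBall x δ).of_isClosed_subset (isClosed_tsupport _) hsup,
    hsup.trans (hx.trans hSΩ)⟩
  have h3 := h.2.2 φ ht
  have hd : pderivA d α φ = fun y => (-1 : ℝ) ^ ord α * pderivA d α κ (x - y) := by
    rw [hφ, pderivA_affine α hκ]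
    funext y
    simp [sub_eq_add_neg]
  have hvan : ∀ k : Ed d → ℝ, tsupport k ⊆ closedBall 0 δ → ∀ w : Ed d → ℝ,
      cv k (S.indicator w) x = ∫ y in Ω, w y * k (x - y) := by
    intro k hk w
    rw [cv_swap, ← integral_indicator hΩ]
    congr 1
    funext y
    by_cases hy : y ∈ S
    · rw [indicator_of_mem hy, indicator_of_mem (hSΩ hy), mul_comm]
    · have h0 : k (x - y) = 0 := by
        by_contra hne
        apply hy
        apply hx
        have : x - y ∈ closedBall (0 : Ed d) δ := hk (subset_tsupport _ hne)
        rw [mem_closedBall, dist_zero_right] at this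
        rwa [mem_closedBall, dist_comm, dist_eq_norm]
      rw [indicator_of_notMem hy, mul_zero]
      by_cases hyΩ : y ∈ Ω
      · rw [indicator_of_mem hyΩ, h0, mul_zero]
      · rw [indicator_of_notMem hyΩ]
  rw [hvan _ ((pderivA_tsupport α hκ).trans hs), hvan _ hs]
  rw [hd] at h3
  have e1 : ∫ y in Ω, u y * ((-1 : ℝ) ^ ord α * pderivA d α κ (x - y))
      = (-1 : ℝ) ^ ord α * ∫ y in Ω, u y * pderivA d α κ (x - y) := by
    rw [← integral_const_mul]
    congr 1
    funext y
    ring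
  have e2 : ∫ y in Ω, v y * φ y = ∫ y in Ω, v y * κ (x - y) := by
    simp [hφ, sub_eq_add_neg]
  rw [e1, e2] at h3
  have hne : ((-1 : ℝ) ^ ord α) ≠ 0 := pow_ne_zero _ (by norm_num)
  exact mul_left_cancel₀ hne h3

lemma translate_cont {d : ℕ} {p : ℝ≥0∞} (hp : 1 ≤ p) (hpt : p ≠ ⊤) {f : Ed d → ℝ}
    (hf : MemLp f p volume) :
    Tendsto (fun t : Ed d => eLpNorm (fun x => f (x - t) - f x) p volume) (𝓝 0) (𝓝 0) := by
  have : Fact (1 ≤ p) := ⟨hp⟩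
  let g : Ed d → C(Ed d, Ed d) := fun t => ⟨fun x => x - t, by fun_prop⟩
  have hg : Continuous g := by
    refine ContinuousMap.continuous_of_continuous_uncurry _ ?_
    exact (continuous_snd.sub continuous_fst)
  have hgm : ∀ t, MeasurePreserving (g t) volume volume := fun t =>
    measurePreserving_sub_right volume t
  have hc := (continuous_const (y := hf.toLp f)).compMeasurePreservingLp hg hgm hpt
  have h0 := (hc.sub (continuous_const (y := hf.toLp f))).tendsto 0
  have e : ∀ t, ‖Lp.compMeasurePreserving (g t) (hgm t) (hf.toLp f) - hf.toLp f‖ₑ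
      = eLpNorm (fun x => f (x - t) - f x) p volume := by
    intro t
    rw [Lp.enorm_def]
    refine eLpNorm_congr_ae ?_
    filter_upwards [Lp.coeFn_sub (Lp.compMeasurePreserving (g t) (hgm t) (hf.toLp f)) (hf.toLp f),
      Lp.coeFn_compMeasurePreserving (hf.toLp f) (hgm t), hf.coeFn_toLp,
      (hgm t).quasiMeasurePreserving.tendsto_ae.eventually hf.coeFn_toLp] with x h1 h2 h3 h4
    rw [h1, Pi.sub_apply, h2, Function.comp_apply, h3, h4]
    rfl
  simp_rw [← e]
  have h1 := h0.enorm
  have e0 := e 0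
  simp only [sub_zero, sub_self] at e0
  have e00 : eLpNorm (fun _ : Ed d => (0 : ℝ)) p volume = 0 := eLpNorm_zero
  rw [e00] at e0
  refine h1.trans (le_of_eq ?_)
  exact congrArg 𝓝 e0

lemma cv_sub_le {d : ℕ} {p : ℝ} (hp : 1 ≤ p) {f : Ed d → ℝ} (hf : StronglyMeasurable f)
    (hfl : LocallyIntegrable f volume)
    (κ : ContDiffBump (0 : Ed d)) (ε : ℝ≥0∞)
    (hε : ∀ t ∈ ball (0 : Ed d) κ.rOut,
      eLpNorm (fun x => f (x - t) - f x) (ENNReal.ofReal p) volume ≤ ε) :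
    eLpNorm (cv (κ.normed volume) f - f) (ENNReal.ofReal p) volume ≤ ε := by
  have hp0 : 0 < p := by linarith
  set k : Ed d → ℝ := κ.normed volume with hk
  set μ : Measure (Ed d) := volume.withDensity (fun t => ENNReal.ofReal (k t)) with hμ
  have hkm : Measurable (fun t => ENNReal.ofReal (k t)) :=
    (κ.continuous_normed.measurable).ennreal_ofReal
  have hprob : IsProbabilityMeasure μ := by
    constructor
    rw [hμ, withDensity_apply _ MeasurableSet.univ, Measure.restrict_univ,
      ← ofReal_integral_eq_lintegral_ofReal κ.integrable_normed (ae_of_all _ κ.nonneg_normed),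
      κ.integral_normed, ENNReal.ofReal_one]
  have hmeas2 : Measurable (fun z : Ed d × Ed d => f (z.1 - z.2) - f z.1) := by
    have := hf.measurable
    fun_prop
  have hpt : ∀ x, ‖(cv k f - f) x‖ₑ ^ p ≤ ∫⁻ t, ‖f (x - t) - f x‖ₑ ^ p ∂μ := by
    intro x
    have hint : Integrable (fun t => k t * f (x - t)) volume :=
      κ.hasCompactSupport_normed.convolutionExists_left (ContinuousLinearMap.mul ℝ ℝ)
        κ.continuous_normed hfl x
    have e1 : (cv k f - f) x = ∫ t, k t * (f (x - t) - f x) := by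
      rw [Pi.sub_apply, cv_apply]
      have : ∫ t, k t * f x = f x := by
        rw [integral_mul_const, κ.integral_normed, one_mul]
      conv_lhs => rw [← this]
      rw [← integral_sub hint (κ.integrable_normed.mul_const _)]
      congr 1
      funext t
      ring
    have e2 : ‖(cv k f - f) x‖ₑ ≤ eLpNorm (fun t => f (x - t) - f x) 1 μ := by
      rw [e1]
      refine (enorm_integral_le_lintegral_enorm _).trans ?_
      rw [eLpNorm_one_eq_lintegral_enorm, hμ, lintegral_withDensity_eq_lintegral_mul _ hkm]
      · refine lintegral_mono fun t => ?_
        rw [enorm_mul, Pi.mul_apply, Real.enorm_eq_ofReal (κ.nonneg_normed t)]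
      · exact (hmeas2.comp (measurable_const.prodMk measurable_id)).enorm
    have e3 : eLpNorm (fun t => f (x - t) - f x) 1 μ ≤
        eLpNorm (fun t => f (x - t) - f x) (ENNReal.ofReal p) μ :=
      eLpNorm_le_eLpNorm_of_exponent_le (by simpa using hp)
        (hmeas2.comp (measurable_const.prodMk measurable_id)).aestronglyMeasurable
    have e4 := ENNReal.rpow_le_rpow (e2.trans e3) hp0.le
    refine e4.trans (le_of_eq ?_)
    rw [eLpNorm_eq_lintegral_rpow_enorm_toReal (by simpa using hp0) ENNReal.ofReal_ne_top,
      ENNReal.toReal_ofReal hp0.le, ← ENNReal.rpow_mul, one_div, inv_mul_cancel₀ hp0.ne',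
      ENNReal.rpow_one]
  have hmain : ∫⁻ x, ‖(cv k f - f) x‖ₑ ^ p ≤ ε ^ p := by
    calc _ ≤ ∫⁻ x, ∫⁻ t, ‖f (x - t) - f x‖ₑ ^ p ∂μ := lintegral_mono hpt
      _ = ∫⁻ t, (∫⁻ x, ‖f (x - t) - f x‖ₑ ^ p) ∂μ :=
        lintegral_lintegral_swap (hmeas2.enorm.pow_const p).aemeasurable
      _ ≤ ∫⁻ t, ε ^ p ∂μ := by
        refine lintegral_mono_ae ?_
        rw [hμ, ae_withDensity_iff hkm]
        refine ae_of_all _ fun t ht => ?_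
        have htm : t ∈ ball (0 : Ed d) κ.rOut := by
          rw [← κ.support_normed_eq (μ := volume)]
          intro h0
          apply ht
          rw [hk, h0, ENNReal.ofReal_zero]
        have := ENNReal.rpow_le_rpow (hε t htm) hp0.le
        rwa [eLpNorm_eq_lintegral_rpow_enorm_toReal (by simpa using hp0) ENNReal.ofReal_ne_top,
          ENNReal.toReal_ofReal hp0.le, ← ENNReal.rpow_mul, one_div, inv_mul_cancel₀ hp0.ne',
          ENNReal.rpow_one] at this
      _ = ε ^ p := by rw [lintegral_const, measure_univ, mul_one]
  rw [eLpNorm_eq_lintegral_rpow_enorm_toReal (by simpa using hp0) ENNReal.ofReal_ne_top,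
          ENNReal.toReal_ofReal hp0.le, one_div]
  exact (ENNReal.rpow_inv_le_iff hp0).2 hmain

/-- A sequence of bumps shrinking to a point. -/
def bmp (d : ℕ) (δ : ℝ) (hδ : 0 < δ) (n : ℕ) : ContDiffBump (0 : Ed d) :=
  ⟨δ / (2 * (n + 1)), δ / (n + 1), by positivity, by
    apply div_lt_div_of_pos_left hδ (by positivity)
    have : (0 : ℝ) ≤ n := Nat.cast_nonneg n
    linarith⟩

lemma cv_tendsto {d : ℕ} {p : ℝ} (hp : 1 ≤ p) {f : Ed d → ℝ}
    (hf : MemLp f (ENNReal.ofReal p) volume) (δ : ℝ) (hδ : 0 < δ) :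
    Tendsto (fun n => eLpNorm (cv ((bmp d δ hδ n).normed volume) f - f) (ENNReal.ofReal p) volume)
      atTop (𝓝 0) := by
  obtain ⟨g, hg, hfg⟩ := hf.1
  have hgp : MemLp g (ENNReal.ofReal p) volume := hf.ae_eq hfg
  have e : ∀ n, eLpNorm (cv ((bmp d δ hδ n).normed volume) f - f) (ENNReal.ofReal p) volume
      = eLpNorm (cv ((bmp d δ hδ n).normed volume) g - g) (ENNReal.ofReal p) volume := by
    intro n
    have : cv ((bmp d δ hδ n).normed volume) f = cv ((bmp d δ hδ n).normed volume) g :=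
      convolution_congr _ (ae_eq_refl _) hfg
    rw [this]
    exact eLpNorm_congr_ae ((ae_eq_refl _).sub hfg)
  simp_rw [e]
  have hp1 : 1 ≤ ENNReal.ofReal p := by simpa using hp
  have ht := translate_cont hp1 ENNReal.ofReal_ne_top hgp
  rw [ENNReal.tendsto_nhds_zero] at ht ⊢
  intro ε hε
  obtain ⟨s, hs, hs'⟩ := Metric.eventually_nhds_iff_ball.1 (ht ε hε)
  have hlim : Tendsto (fun n : ℕ => δ / ((n : ℝ) + 1)) atTop (𝓝 0) :=
    tendsto_const_div_atTop_nhds_zero_nat δ |>.comp (tendsto_add_atTop_nat 1) |>.congr (by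
      intro n; simp)
  filter_upwards [hlim.eventually (gt_mem_nhds hs)] with n hn
  exact cv_sub_le hp hg (hgp.locallyIntegrable hp1) _ ε fun t ht' =>
    hs' t (ball_subset_ball hn.le ht')

/-- Local approximation by smooth functions. -/
lemma smooth_approx {d m : ℕ} {p : ℝ} (hp : 1 ≤ p) {Ω K : Set (Ed d)} (hΩ : IsOpen Ω)
    (hK : IsCompact K) (hKΩ : K ⊆ Ω) {u : Ed d → ℝ} {D : (Fin d → ℕ) → Ed d → ℝ}
    (h : IsWeakDerivFamily d Ω m u D)
    (hD : ∀ α ∈ multiIdx d m, ∀ S : Set (Ed d), IsCompact S → S ⊆ Ω →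
      MemLp (D α) (ENNReal.ofReal p) (volume.restrict S)) :
    ∃ w : ℕ → Ed d → ℝ, (∀ n, Sm (w n)) ∧ ∀ α ∈ multiIdx d m,
      Tendsto (fun n => eLpNorm (pderivA d α (w n) - D α) (ENNReal.ofReal p)
        (volume.restrict K)) atTop (𝓝 0) := by
  obtain ⟨δ, hδ, hδΩ⟩ := hK.exists_cthickening_subset_open hΩ hKΩ
  set S := cthickening δ K with hS
  have hSc : IsCompact S := hK.cthickening
  have hSm : MeasurableSet S := hSc.measurableSet
  have h0 : (0 : Fin d → ℕ) ∈ multiIdx d m := mem_multiIdx.2 (by simp [ord])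
  have hu : LocallyIntegrable (S.indicator u) volume :=
    (((h 0 h0).1.integrableOn_compact_subset hδΩ hSc).integrable_indicator hSm).locallyIntegrable
  have hks : ∀ n, Sm ((bmp d δ hδ n).normed volume) := fun n => (bmp d δ hδ n).contDiff_normed
  refine ⟨fun n => cv ((bmp d δ hδ n).normed volume) (S.indicator u),
    fun n => cv_sm (hks n) (bmp d δ hδ n).hasCompactSupport_normed hu, fun α hα => ?_⟩
  have hg : MemLp (S.indicator (D α)) (ENNReal.ofReal p) volume :=
    (memLp_indicator_iff_restrict hSm).2 (hD α hα S hSc hδΩ)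
  refine tendsto_of_tendsto_of_tendsto_of_le_of_le tendsto_const_nhds (cv_tendsto hp hg δ hδ)
    (fun n => zero_le) fun n => ?_
  refine le_trans (le_of_eq ?_) (eLpNorm_mono_measure _ (Measure.restrict_le_self (s := K)))
  refine eLpNorm_congr_ae ?_
  filter_upwards [ae_restrict_mem hK.measurableSet] with x hx
  have hxS : closedBall x δ ⊆ S := closedBall_subset_cthickening hx δ
  have hts : tsupport ((bmp d δ hδ n).normed volume) ⊆ closedBall 0 δ := by
    rw [(bmp d δ hδ n).tsupport_normed_eq]
    refine closedBall_subset_closedBall ?_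
    have : (0 : ℝ) ≤ n := Nat.cast_nonneg n
    exact div_le_self hδ.le (by linarith)
  rw [Pi.sub_apply, Pi.sub_apply, cv_pderivA (hks n) (bmp d δ hδ n).hasCompactSupport_normed hu,
    cv_weak (h α hα) hSm hδΩ hΩ.measurableSet (hks n) hts x hxS,
    indicator_of_mem (hxS (mem_closedBall_self hδ.le))]

lemma fatou_lp {d : ℕ} {μ : Measure (Ed d)} {p : ℝ≥0∞} {X : ℕ → Ed d → ℝ} {Y : Ed d → ℝ}
    (hX : ∀ n, AEStronglyMeasurable (X n) μ)
    (hlim : ∀ᵐ x ∂μ, Tendsto (fun n => X n x) atTop (𝓝 (Y x))) {G : ℕ → ℝ≥0∞} {G0 : ℝ≥0∞}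
    (hG : ∀ n, eLpNorm (X n) p μ ≤ G n) (hG0 : Tendsto G atTop (𝓝 G0)) : eLpNorm Y p μ ≤ G0 := by
  refine (Lp.eLpNorm_lim_le_liminf_eLpNorm hX Y hlim).trans ?_
  rw [← hG0.liminf_eq]
  exact liminf_le_liminf (Eventually.of_forall hG)

lemma Wr_add_le {d m : ℕ} {p : ℝ} (hp : 1 ≤ p) (y : Ed d) (r : ℝ)
    (D E F : (Fin d → ℕ) → Ed d → ℝ)
    (hD : ∀ α ∈ multiIdx d m, AEStronglyMeasurable (D α) (volume.restrict (closedBall y (2 * r))))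
    (hE : ∀ α ∈ multiIdx d m, AEStronglyMeasurable (E α) (volume.restrict (closedBall y (2 * r))))
    (hF : ∀ α ∈ multiIdx d m, ∀ x, ‖F α x‖ ≤ ‖(D α + E α) x‖) :
    Wr d m p y r F ≤ Wr d m p y r D + Wr d m p y r E := by
  rw [Wr, Wr, Wr, ← Finset.sum_add_distrib]
  refine Finset.sum_le_sum fun α hα => ?_
  rw [← mul_add]
  gcongr
  exact (eLpNorm_mono (hF α hα)).trans (eLpNorm_add_le (hD α hα) (hE α hα) (by simpa using hp))

lemma Wr_tendsto {d m : ℕ} {p : ℝ} (y : Ed d) (r : ℝ)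
    (D : ℕ → (Fin d → ℕ) → Ed d → ℝ)
    (h : ∀ α ∈ multiIdx d m, Tendsto (fun n => eLpNorm (D n α) (ENNReal.ofReal p)
        (volume.restrict (closedBall y (2 * r)))) atTop (𝓝 0)) :
    Tendsto (fun n => Wr d m p y r (D n)) atTop (𝓝 0) := by
  have : (0 : ℝ≥0∞) = ∑ α ∈ multiIdx d m, ENNReal.ofReal (r ^ ord α) * 0 := by simp
  rw [this]
  refine tendsto_finsetSum _ fun α hα => ?_
  exact ENNReal.Tendsto.const_mul (h α hα) (Or.inr ENNReal.ofReal_ne_top)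

lemma Wr_lt_top {d m : ℕ} {p : ℝ} (y : Ed d) (r : ℝ)
    (D : (Fin d → ℕ) → Ed d → ℝ)
    (h : ∀ α ∈ multiIdx d m, MemLp (D α) (ENNReal.ofReal p)
        (volume.restrict (closedBall y (2 * r)))) : Wr d m p y r D ≠ ⊤ := by
  rw [Wr]
  refine (ENNReal.sum_lt_top.2 fun α hα => ?_).ne
  exact ENNReal.mul_lt_top ENNReal.ofReal_lt_top (h α hα).2

/-- Bilinear estimate statement (conclusion of `prod_scaled`). -/
def BilEst (d m : ℕ) (p : ℝ) (C : ℝ≥0) : Prop :=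
  ∀ f g : Ed d → ℝ, Sm f → Sm g → ∀ β δ, ord β + ord δ ≤ m →
      ∀ (y : Ed d) (r : ℝ), 0 < r →
      ENNReal.ofReal (r ^ (ord β + ord δ)) *
      eLpNorm (pderivA d β f * pderivA d δ g) (ENNReal.ofReal p) (volume.restrict (ball y r)) ≤
        C * ENNReal.ofReal (r ^ (-((d : ℝ) / p))) *
          (Wr d m p y r (fun α => pderivA d α f) * Wr d m p y r (fun α => pderivA d α g))

lemma prod_tendsto {d m : ℕ} {p : ℝ} (hp : 1 ≤ p) {C : ℝ≥0} (hC : BilEst d m p C)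
    {w z : ℕ → Ed d → ℝ} (hw : ∀ n, Sm (w n)) (hz : ∀ n, Sm (z n))
    {D E : (Fin d → ℕ) → Ed d → ℝ} {y : Ed d} {r : ℝ} (hr : 0 < r)
    (hD : ∀ α ∈ multiIdx d m, MemLp (D α) (ENNReal.ofReal p)
        (volume.restrict (closedBall y (2 * r))))
    (hE : ∀ α ∈ multiIdx d m, MemLp (E α) (ENNReal.ofReal p)
        (volume.restrict (closedBall y (2 * r))))
    (hwD : ∀ α ∈ multiIdx d m, Tendsto (fun n => eLpNorm (pderivA d α (w n) - D α)
      (ENNReal.ofReal p) (volume.restrict (closedBall y (2 * r)))) atTop (𝓝 0))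
    (hzE : ∀ α ∈ multiIdx d m, Tendsto (fun n => eLpNorm (pderivA d α (z n) - E α)
      (ENNReal.ofReal p) (volume.restrict (closedBall y (2 * r)))) atTop (𝓝 0))
    {β δ : Fin d → ℕ} (h : ord β + ord δ ≤ m) :
    Tendsto (fun n => eLpNorm (pderivA d β (w n) * pderivA d δ (z n) - D β * E δ)
      (ENNReal.ofReal p) (volume.restrict (ball y r))) atTop (𝓝 0) ∧
    ENNReal.ofReal (r ^ (ord β + ord δ)) *
      eLpNorm (D β * E δ) (ENNReal.ofReal p) (volume.restrict (ball y r)) ≤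
        C * ENNReal.ofReal (r ^ (-((d : ℝ) / p))) * (Wr d m p y r D * Wr d m p y r E) := by
  have hp0 : 0 < p := by linarith
  have hp1 : 1 ≤ ENNReal.ofReal p := by simpa using hp
  have hpne : ENNReal.ofReal p ≠ 0 := by simpa using hp0
  have hβ : β ∈ multiIdx d m := mem_multiIdx.2 (by omega)
  have hδ : δ ∈ multiIdx d m := mem_multiIdx.2 (by omega)
  set a : ℕ → ℝ≥0∞ := fun n => Wr d m p y r (fun α => pderivA d α (w n) - D α) with ha
  set b : ℕ → ℝ≥0∞ := fun n => Wr d m p y r (fun α => pderivA d α (z n) - E α) with hb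
  have ha0 : Tendsto a atTop (𝓝 0) := Wr_tendsto y r _ hwD
  have hb0 : Tendsto b atTop (𝓝 0) := Wr_tendsto y r _ hzE
  have hA : Wr d m p y r D ≠ ⊤ := Wr_lt_top y r D hD
  have hB : Wr d m p y r E ≠ ⊤ := Wr_lt_top y r E hE
  set A := Wr d m p y r D
  set B := Wr d m p y r E
  set c := ENNReal.ofReal (r ^ (ord β + ord δ)) with hc
  have hc0 : c ≠ 0 := by rw [hc]; simp; positivity
  have hct : c ≠ ⊤ := ENNReal.ofReal_ne_top
  set κ := ENNReal.ofReal (r ^ (-((d : ℝ) / p)))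
  have hκt : κ ≠ ⊤ := ENNReal.ofReal_ne_top
  -- measurability
  have hsm : ∀ (f : Ed d → ℝ) (α : Fin d → ℕ) (μ : Measure (Ed d)), Sm f →
      AEStronglyMeasurable (pderivA d α f) μ := fun f α μ hf =>
    (sm_pderivA α hf).continuous.aestronglyMeasurable
  have hwa : ∀ n, Wr d m p y r (fun α => pderivA d α (w n)) ≤ A + a n := fun n =>
    Wr_add_le hp y r D (fun α => pderivA d α (w n) - D α) _ (fun α hα => (hD α hα).1)
      (fun α hα => (hsm _ _ _ (hw n)).sub (hD α hα).1) (fun α _ x => by simp)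
  have hzb : ∀ n, Wr d m p y r (fun α => pderivA d α (z n)) ≤ B + b n := fun n =>
    Wr_add_le hp y r E (fun α => pderivA d α (z n) - E α) _ (fun α hα => (hE α hα).1)
      (fun α hα => (hsm _ _ _ (hz n)).sub (hE α hα).1) (fun α _ x => by simp)
  have hww : ∀ n k, Wr d m p y r (fun α => pderivA d α (w n - w k)) ≤ a n + a k := fun n k =>
    (Wr_add_le hp y r (fun α => pderivA d α (w n) - D α) (fun α => -(pderivA d α (w k) - D α)) _
      (fun α hα => (hsm _ _ _ (hw n)).sub (hD α hα).1)
      (fun α hα => ((hsm _ _ _ (hw k)).sub (hD α hα).1).neg)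
      (fun α _ x => by rw [pderivA_sub _ (hw n) (hw k)]; simp)).trans (le_of_eq (by
        simp only [Wr, eLpNorm_neg, ha]))
  have hzz : ∀ n k, Wr d m p y r (fun α => pderivA d α (z n - z k)) ≤ b n + b k := fun n k =>
    (Wr_add_le hp y r (fun α => pderivA d α (z n) - E α) (fun α => -(pderivA d α (z k) - E α)) _
      (fun α hα => (hsm _ _ _ (hz n)).sub (hE α hα).1)
      (fun α hα => ((hsm _ _ _ (hz k)).sub (hE α hα).1).neg)
      (fun α _ x => by rw [pderivA_sub _ (hz n) (hz k)]; simp)).trans (le_of_eq (by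
        simp only [Wr, eLpNorm_neg, hb]))
  set M : ℝ≥0∞ := c⁻¹ * (C * κ) with hM
  have hMt : M ≠ ⊤ := ENNReal.mul_ne_top (ENNReal.inv_ne_top.2 hc0)
    (ENNReal.mul_ne_top ENNReal.coe_ne_top hκt)
  have hest : ∀ f g : Ed d → ℝ, Sm f → Sm g →
      eLpNorm (pderivA d β f * pderivA d δ g) (ENNReal.ofReal p) (volume.restrict (ball y r)) ≤
      M * (Wr d m p y r (fun α => pderivA d α f) * Wr d m p y r (fun α => pderivA d α g)) := by
    intro f g hf hg
    rw [hM, mul_assoc, ← ENNReal.mul_le_iff_le_inv hc0 hct]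
    exact hC f g hf hg β δ h y r hr
  -- a.e. convergent subsequences
  obtain ⟨ns, hns, hns'⟩ := (tendstoInMeasure_of_tendsto_eLpNorm hpne
    (fun n => hsm (w n) β _ (hw n)) (hD β hβ).1 (hwD β hβ)).exists_seq_tendsto_ae
  obtain ⟨ks, hks, hks'⟩ := (tendstoInMeasure_of_tendsto_eLpNorm hpne
    (fun n => hsm (z (ns n)) δ _ (hz (ns n))) (hE δ hδ).1
      ((hzE δ hδ).comp hns.tendsto_atTop)).exists_seq_tendsto_ae
  set js := ns ∘ ks with hjs
  have hj : Tendsto js atTop atTop := hns.tendsto_atTop.comp hks.tendsto_atTop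
  have hsub : ball y r ⊆ closedBall y (2 * r) :=
    ball_subset_closedBall.trans (closedBall_subset_closedBall (by linarith))
  have hae : ∀ᵐ x ∂(volume.restrict (ball y r)),
      Tendsto (fun k => pderivA d β (w (js k)) x) atTop (𝓝 (D β x)) ∧
      Tendsto (fun k => pderivA d δ (z (js k)) x) atTop (𝓝 (E δ x)) := by
    refine ae_restrict_of_ae_restrict_of_subset hsub ?_
    filter_upwards [hns', hks'] with x h1 h2
    exact ⟨h1.comp hks.tendsto_atTop, h2⟩
  set X : ℕ → Ed d → ℝ := fun n => pderivA d β (w n) * pderivA d δ (z n) with hX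
  have hXm : ∀ n, AEStronglyMeasurable (X n) (volume.restrict (ball y r)) := fun n =>
    (hsm _ _ _ (hw n)).mul (hsm _ _ _ (hz n))
  have haj : Tendsto (fun k => a (js k)) atTop (𝓝 0) := ha0.comp hj
  have hbj : Tendsto (fun k => b (js k)) atTop (𝓝 0) := hb0.comp hj
  -- the bound
  have hbd : ∀ n k, eLpNorm (X n - X k) (ENNReal.ofReal p) (volume.restrict (ball y r)) ≤
      M * ((a n + a k) * (B + b n)) + M * ((A + a k) * (b n + b k)) := by
    intro n k
    have e : X n - X k = pderivA d β (w n - w k) * pderivA d δ (z n) +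
        pderivA d β (w k) * pderivA d δ (z n - z k) := by
      rw [pderivA_sub _ (hw n) (hw k), pderivA_sub _ (hz n) (hz k)]
      funext x
      simp only [hX, Pi.sub_apply, Pi.mul_apply, Pi.add_apply]
      ring
    have hs1 := sm_sub (hw n) (hw k)
    have hs2 := sm_sub (hz n) (hz k)
    rw [e]
    refine (eLpNorm_add_le ((hsm _ _ _ hs1).mul (hsm _ _ _ (hz n)))
      ((hsm _ _ _ (hw k)).mul (hsm _ _ _ hs2)) hp1).trans ?_
    refine add_le_add ((hest _ _ hs1 (hz n)).trans ?_) ((hest _ _ (hw k) hs2).trans ?_)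
    · gcongr
      · exact hww n k
      · exact hzb n
    · gcongr
      · exact hwa k
      · exact hzz n k
  have hfin : ∀ᶠ n in atTop, a n ≠ ⊤ ∧ b n ≠ ⊤ := by
    filter_upwards [ha0.eventually (gt_mem_nhds one_pos), hb0.eventually (gt_mem_nhds one_pos)]
      with n h1 h2
    exact ⟨(h1.trans ENNReal.one_lt_top).ne, (h2.trans ENNReal.one_lt_top).ne⟩
  have hbd2 : ∀ᶠ n in atTop,
      eLpNorm (X n - D β * E δ) (ENNReal.ofReal p) (volume.restrict (ball y r)) ≤
      M * (a n * (B + b n)) + M * (A * b n) := by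
    filter_upwards [hfin] with n hn
    refine fatou_lp (X := fun k => X n - X (js k)) (fun k => (hXm n).sub (hXm _)) ?_
      (fun k => hbd n (js k)) ?_
    · filter_upwards [hae] with x hx
      exact tendsto_const_nhds.sub (hx.1.mul hx.2)
    · have t1 : Tendsto (fun k => (a n + a (js k)) * (B + b n)) atTop
          (𝓝 ((a n + 0) * (B + b n))) :=
        ENNReal.Tendsto.mul_const (tendsto_const_nhds.add haj)
          (Or.inr (ENNReal.add_ne_top.2 ⟨hB, hn.2⟩))
      have t2 : Tendsto (fun k => (A + a (js k)) * (b n + b (js k))) atTop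
          (𝓝 ((A + 0) * (b n + 0))) :=
        ENNReal.Tendsto.mul (tendsto_const_nhds.add haj) (Or.inr (by simpa using hn.2))
          (tendsto_const_nhds.add hbj) (Or.inr (by simpa using hA))
      simp only [add_zero] at t1 t2
      exact (ENNReal.Tendsto.const_mul t1 (Or.inr hMt)).add
        (ENNReal.Tendsto.const_mul t2 (Or.inr hMt))
  constructor
  · refine tendsto_of_tendsto_of_tendsto_of_le_of_le' tendsto_const_nhds ?_
      (Eventually.of_forall fun _ => zero_le) hbd2
    have t1 : Tendsto (fun n => a n * (B + b n)) atTop (𝓝 (0 * (B + 0))) :=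
      ENNReal.Tendsto.mul ha0 (Or.inr (by simpa using hB)) (tendsto_const_nhds.add hb0)
        (Or.inr ENNReal.zero_ne_top)
    have t2 : Tendsto (fun n => A * b n) atTop (𝓝 (A * 0)) :=
      ENNReal.Tendsto.const_mul hb0 (Or.inr hA)
    have t3 := (ENNReal.Tendsto.const_mul t1 (Or.inr hMt)).add
        (ENNReal.Tendsto.const_mul t2 (Or.inr hMt))
    simpa using t3
  · have := fatou_lp (p := ENNReal.ofReal p) (X := fun k => X (js k)) (Y := D β * E δ)
      (G := fun k => M * ((A + a (js k)) * (B + b (js k)))) (G0 := M * (A * B)) (fun k => hXm _)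
      (by
        filter_upwards [hae] with x hx
        exact hx.1.mul hx.2)
      (fun k => (hest _ _ (hw _) (hz _)).trans (by
        gcongr
        · exact hwa _
        · exact hzb _))
      (by
        have t2 : Tendsto (fun k => (A + a (js k)) * (B + b (js k))) atTop
            (𝓝 ((A + 0) * (B + 0))) :=
          ENNReal.Tendsto.mul (tendsto_const_nhds.add haj) (Or.inr (by simpa using hB))
            (tendsto_const_nhds.add hbj) (Or.inr (by simpa using hA))
        simp only [add_zero] at t2
        exact ENNReal.Tendsto.const_mul t2 (Or.inr hMt))
    rwa [hM, mul_assoc, ← ENNReal.mul_le_iff_le_inv hc0 hct] at this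

lemma weak_unique {d : ℕ} {Ω : Set (Ed d)} (hΩ : IsOpen Ω) {α : Fin d → ℕ} {u v v' : Ed d → ℝ}
    (h : HasWeakDerivOn d Ω α u v) (h' : HasWeakDerivOn d Ω α u v') :
    v =ᵐ[volume.restrict Ω] v' := by
  have key : ∀ᵐ x ∂(volume : Measure (Ed d)), x ∈ Ω → (v - v') x = 0 := by
    refine hΩ.ae_eq_zero_of_integral_contDiff_smul_eq_zero (h.2.1.sub h'.2.1) fun g hg hc hs => ?_
    have ht : IsTestFun d Ω g := ⟨hg, hc, hs⟩
    have e := (h.2.2 g ht).symm.trans (h'.2.2 g ht)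
    have hne : ((-1 : ℝ) ^ ∑ i, α i) ≠ 0 := pow_ne_zero _ (by norm_num)
    have e' := mul_left_cancel₀ hne e
    have hi : ∀ v : Ed d → ℝ, LocallyIntegrableOn v Ω volume →
        Integrable (fun x => v x * g x) volume ∧ ∫ x in Ω, v x * g x = ∫ x, v x * g x := by
      intro v hv
      constructor
      · have h1 := hv.integrableOn_compact_subset hs hc
        have h2 : IntegrableOn (fun x => v x * g x) (tsupport g) volume :=
          h1.mul_continuousOn hg.continuous.continuousOn hc
        rw [integrableOn_iff_integrable_of_support_subset] at h2
        · exact h2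
        · intro x hx
          apply subset_tsupport
          intro h0
          exact hx (by simp [h0])
      · refine setIntegral_eq_integral_of_forall_compl_eq_zero fun x hx => ?_
        have : g x = 0 := by
          by_contra h0
          exact hx (hs (subset_tsupport _ h0))
        rw [this, mul_zero]
    obtain ⟨i1, e1⟩ := hi v h.2.1
    obtain ⟨i2, e2⟩ := hi v' h'.2.1
    rw [e1, e2] at e'
    calc ∫ x, g x • (v - v') x = ∫ x, (v x * g x - v' x * g x) := by
          congr 1; funext x; simp; ring
      _ = 0 := by rw [integral_sub i1 i2, e', sub_self]
  rw [Filter.EventuallyEq, ae_restrict_iff' hΩ.measurableSet]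
  filter_upwards [key] with x hx hxΩ
  exact sub_eq_zero.1 (hx hxΩ)

lemma weak_zero {d : ℕ} {Ω : Set (Ed d)} {u : Ed d → ℝ} (h : LocallyIntegrableOn u Ω volume) :
    HasWeakDerivOn d Ω 0 u u := by
  refine ⟨h, h, fun φ _ => ?_⟩
  rw [pderivA_zero]
  simp

/-- Data for the local theory. -/
structure LocData (d m : ℕ) (p : ℝ) (Ω : Set (Ed d)) (u : Ed d → ℝ)
    (D : (Fin d → ℕ) → Ed d → ℝ) : Prop where
  wk : IsWeakDerivFamily d Ω m u D
  lp : ∀ α ∈ multiIdx d m, ∀ S : Set (Ed d), IsCompact S → S ⊆ Ω →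
      MemLp (D α) (ENNReal.ofReal p) (volume.restrict S)

/-- The local product estimate for Sobolev families. -/
lemma loc_prod {d m : ℕ} {p : ℝ} (hp : 1 ≤ p) {C : ℝ≥0} (hC : BilEst d m p C)
    {Ω : Set (Ed d)} (hΩ : IsOpen Ω) {u v : Ed d → ℝ} {D E : (Fin d → ℕ) → Ed d → ℝ}
    (hu : LocData d m p Ω u D) (hv : LocData d m p Ω v E) {y : Ed d} {r : ℝ} (hr : 0 < r)
    (hy : closedBall y (2 * r) ⊆ Ω) {β δ : Fin d → ℕ} (h : ord β + ord δ ≤ m) :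
    MemLp (D β * E δ) (ENNReal.ofReal p) (volume.restrict (ball y r)) ∧
    ENNReal.ofReal (r ^ (ord β + ord δ)) *
      eLpNorm (D β * E δ) (ENNReal.ofReal p) (volume.restrict (ball y r)) ≤
        C * ENNReal.ofReal (r ^ (-((d : ℝ) / p))) * (Wr d m p y r D * Wr d m p y r E) := by
  have hc := isCompact_closedBall y (2 * r)
  obtain ⟨w, hw, hwD⟩ := smooth_approx hp hΩ hc hy hu.wk hu.lp
  obtain ⟨z, hz, hzE⟩ := smooth_approx hp hΩ hc hy hv.wk hv.lp
  have hD := fun α hα => hu.lp α hα _ hc hy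
  have hE := fun α hα => hv.lp α hα _ hc hy
  have h2 := (prod_tendsto hp hC hw hz hr hD hE hwD hzE h).2
  refine ⟨⟨?_, ?_⟩, h2⟩
  · have hsub : ball y r ⊆ closedBall y (2 * r) :=
      ball_subset_closedBall.trans (closedBall_subset_closedBall (by linarith))
    exact ((hD β (mem_multiIdx.2 (by omega))).1.mul
      (hE δ (mem_multiIdx.2 (by omega))).1).mono_measure (Measure.restrict_mono_set _ hsub)
  · have hc0 : ENNReal.ofReal (r ^ (ord β + ord δ)) ≠ 0 := by simp; positivity
    have ht : C * ENNReal.ofReal (r ^ (-((d : ℝ) / p))) * (Wr d m p y r D * Wr d m p y r E) < ⊤ :=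
      ENNReal.mul_lt_top (ENNReal.mul_lt_top ENNReal.coe_lt_top ENNReal.ofReal_lt_top)
        (ENNReal.mul_lt_top (Wr_lt_top y r D hD).lt_top (Wr_lt_top y r E hE).lt_top)
    by_contra hcon
    rw [not_lt, top_le_iff] at hcon
    rw [hcon, ENNReal.mul_top hc0] at h2
    exact absurd (h2.trans_lt ht) (lt_irrefl _)

lemma loc_int {d m : ℕ} {p : ℝ} (hp : 1 ≤ p) {C : ℝ≥0} (hC : BilEst d m p C)
    {Ω : Set (Ed d)} (hΩ : IsOpen Ω) {u v : Ed d → ℝ} {D E : (Fin d → ℕ) → Ed d → ℝ}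
    (hu : LocData d m p Ω u D) (hv : LocData d m p Ω v E) {β δ : Fin d → ℕ}
    (h : ord β + ord δ ≤ m) : LocallyIntegrableOn (D β * E δ) Ω volume := by
  intro x hx
  obtain ⟨ε, hε, hεΩ⟩ := Metric.isOpen_iff.1 hΩ x hx
  refine ⟨ball x (ε / 4), mem_nhdsWithin_of_mem_nhds (ball_mem_nhds x (by positivity)), ?_⟩
  have hfin : IsFiniteMeasure (volume.restrict (ball x (ε / 4))) :=
    ⟨by rw [Measure.restrict_apply_univ]; exact measure_ball_lt_top⟩
  refine (loc_prod hp hC hΩ hu hv (y := x) (r := ε / 4) (by positivity) ?_ h).1.integrable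
    (by simpa using hp)
  exact (closedBall_subset_ball (by linarith)).trans hεΩ

lemma lsum_int {d : ℕ} (L : List ((Fin d → ℕ) × (Fin d → ℕ))) (D E : (Fin d → ℕ) → Ed d → ℝ)
    (Ω : Set (Ed d)) (h : ∀ q ∈ L, LocallyIntegrableOn (D q.1 * E q.2) Ω volume) :
    LocallyIntegrableOn (lsum L D E) Ω volume := by
  induction L with
  | nil => exact locallyIntegrableOn_zero
  | cons q L ih =>
    have e : lsum (q :: L) D E = D q.1 * E q.2 + lsum L D E := rfl
    rw [e]
    exact (h q List.mem_cons_self).add (ih fun q hq => h q (List.mem_cons_of_mem _ hq))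

lemma loc_L1 {d m : ℕ} {p : ℝ} (hp : 1 ≤ p) {C : ℝ≥0} (hC : BilEst d m p C)
    {Ω K : Set (Ed d)} (hΩ : IsOpen Ω) (hK : IsCompact K) (hKΩ : K ⊆ Ω) {u v : Ed d → ℝ}
    {D E : (Fin d → ℕ) → Ed d → ℝ}
    (hu : LocData d m p Ω u D) (hv : LocData d m p Ω v E) :
    ∃ w z : ℕ → Ed d → ℝ, (∀ n, Sm (w n)) ∧ (∀ n, Sm (z n)) ∧
      ∀ β δ : Fin d → ℕ, ord β + ord δ ≤ m →
      Tendsto (fun n => ∫⁻ x in K, ‖(pderivA d β (w n) * pderivA d δ (z n)) x - (D β * E δ) x‖ₑ)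
        atTop (𝓝 0) := by
  obtain ⟨ε, hε, hεΩ⟩ := hK.exists_cthickening_subset_open hΩ hKΩ
  have hSc : IsCompact (cthickening ε K) := hK.cthickening
  obtain ⟨w, hw, hwD⟩ := smooth_approx hp hΩ hSc hεΩ hu.wk hu.lp
  obtain ⟨z, hz, hzE⟩ := smooth_approx hp hΩ hSc hεΩ hv.wk hv.lp
  refine ⟨w, z, hw, hz, fun β δ h => ?_⟩
  refine hK.induction_on (p := fun S => Tendsto (fun n => ∫⁻ x in S,
    ‖(pderivA d β (w n) * pderivA d δ (z n)) x - (D β * E δ) x‖ₑ) atTop (𝓝 0)) ?_ ?_ ?_ ?_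
  · simp
  · intro s t hst ht
    exact tendsto_of_tendsto_of_tendsto_of_le_of_le tendsto_const_nhds ht (fun _ => zero_le)
      fun n => lintegral_mono_set hst
  · intro s t hs ht
    refine tendsto_of_tendsto_of_tendsto_of_le_of_le tendsto_const_nhds
      (by simpa using hs.add ht) (fun _ => zero_le) fun n => lintegral_union_le _ s t
  · intro y hy
    refine ⟨ball y (ε / 2), mem_nhdsWithin_of_mem_nhds (ball_mem_nhds y (by positivity)), ?_⟩
    have hsub : closedBall y (2 * (ε / 2)) ⊆ cthickening ε K := by
      rw [mul_div_cancel₀ _ two_ne_zero]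
      exact closedBall_subset_cthickening hy ε
    have hc := isCompact_closedBall y (2 * (ε / 2))
    have hD := fun α hα => hu.lp α hα _ hc (hsub.trans hεΩ)
    have hE := fun α hα => hv.lp α hα _ hc (hsub.trans hεΩ)
    have hmono : ∀ f : ℕ → Ed d → ℝ, Tendsto (fun n => eLpNorm (f n) (ENNReal.ofReal p)
        (volume.restrict (cthickening ε K))) atTop (𝓝 0) →
        Tendsto (fun n => eLpNorm (f n) (ENNReal.ofReal p)
        (volume.restrict (closedBall y (2 * (ε / 2))))) atTop (𝓝 0) := fun f hf =>
      tendsto_of_tendsto_of_tendsto_of_le_of_le tendsto_const_nhds hf (fun _ => zero_le)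
        fun n => eLpNorm_mono_measure _ (Measure.restrict_mono_set _ hsub)
    have h2 := (prod_tendsto hp hC hw hz (by positivity) hD hE (fun α hα => hmono _ (hwD α hα))
      (fun α hα => hmono _ (hzE α hα)) h).1
    have hfin : IsFiniteMeasure (volume.restrict (ball y (ε / 2))) :=
      ⟨by rw [Measure.restrict_apply_univ]; exact measure_ball_lt_top⟩
    have hm := (loc_prod hp hC hΩ hu hv (by positivity) (hsub.trans hεΩ) h).1.1
    set V := (volume.restrict (ball y (ε / 2)) : Measure (Ed d)) univ ^
      (1 / (1 : ℝ≥0∞).toReal - 1 / (ENNReal.ofReal p).toReal) with hV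
    have hVt : V ≠ ⊤ := by
      rw [hV, ENNReal.toReal_ofReal (by linarith), ENNReal.toReal_one]
      refine ENNReal.rpow_ne_top_of_nonneg ?_ (measure_ne_top _ _)
      rw [sub_nonneg, div_one, div_le_one (by linarith)]
      exact hp
    have h3 := ENNReal.Tendsto.mul_const h2 (Or.inr hVt)
    rw [zero_mul] at h3
    refine tendsto_of_tendsto_of_tendsto_of_le_of_le tendsto_const_nhds h3 (fun _ => zero_le)
      fun n => ?_
    have h4 := eLpNorm_le_eLpNorm_mul_rpow_measure_univ (p := 1) (q := ENNReal.ofReal p)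
      (μ := volume.restrict (ball y (ε / 2)))
      (f := pderivA d β (w n) * pderivA d δ (z n) - D β * E δ) (by simpa using hp)
      ((((sm_pderivA _ (hw n)).continuous.mul
        (sm_pderivA _ (hz n)).continuous).aestronglyMeasurable).sub hm)
    rw [eLpNorm_one_eq_lintegral_enorm] at h4
    exact h4

lemma lsum_L1 {d : ℕ} (L : List ((Fin d → ℕ) × (Fin d → ℕ))) {K : Set (Ed d)}
    (D E : (Fin d → ℕ) → Ed d → ℝ) (Dn En : ℕ → (Fin d → ℕ) → Ed d → ℝ)
    (hm : ∀ n, ∀ q ∈ L, AEStronglyMeasurable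
      (fun x => (Dn n q.1 * En n q.2) x - (D q.1 * E q.2) x) (volume.restrict K))
    (h : ∀ q ∈ L, Tendsto (fun n => ∫⁻ x in K, ‖(Dn n q.1 * En n q.2) x - (D q.1 * E q.2) x‖ₑ)
        atTop (𝓝 0)) :
    Tendsto (fun n => ∫⁻ x in K, ‖lsum L (Dn n) (En n) x - lsum L D E x‖ₑ) atTop (𝓝 0) := by
  induction L with
  | nil => simp [lsum]
  | cons q L ih =>
    have i1 := ih (fun n q hq => hm n q (List.mem_cons_of_mem _ hq))
      (fun q hq => h q (List.mem_cons_of_mem _ hq))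
    have i2 := h q List.mem_cons_self
    have i3 := i2.add i1
    rw [add_zero] at i3
    refine tendsto_of_tendsto_of_tendsto_of_le_of_le tendsto_const_nhds i3 (fun _ => zero_le)
      fun n => ?_
    dsimp only
    rw [← lintegral_add_left' (hm n q List.mem_cons_self).enorm]
    refine lintegral_mono fun x => ?_
    have e : lsum (q :: L) (Dn n) (En n) x - lsum (q :: L) D E x =
      ((Dn n q.1 * En n q.2) x - (D q.1 * E q.2) x) + (lsum L (Dn n) (En n) x - lsum L D E x) := by
      simp only [lsum, List.map_cons, List.sum_cons, Pi.mul_apply]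
      ring
    rw [e]
    exact enorm_add_le _ _

lemma pair_tendsto {d : ℕ} {Ω K : Set (Ed d)} (hK : IsCompact K) (hKΩ : K ⊆ Ω)
    (hΩ : MeasurableSet Ω)
    {X : ℕ → Ed d → ℝ} {Y ψ : Ed d → ℝ} (hψ : Continuous ψ) (hψK : tsupport ψ ⊆ K)
    (hX : ∀ n, IntegrableOn (X n) K volume) (hY : IntegrableOn Y K volume)
    (h : Tendsto (fun n => ∫⁻ x in K, ‖X n x - Y x‖ₑ) atTop (𝓝 0)) :
    Tendsto (fun n => ∫ x, X n x * ψ x) atTop (𝓝 (∫ x in Ω, Y x * ψ x)) := by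
  have h0 : ∀ x, x ∉ K → ψ x = 0 := fun x hx => by
    by_contra hne
    exact hx (hψK (subset_tsupport _ hne))
  have e1 : ∀ n, ∫ x, X n x * ψ x = ∫ x in K, X n x * ψ x := fun n =>
    (setIntegral_eq_integral_of_forall_compl_eq_zero fun x hx => by rw [h0 x hx, mul_zero]).symm
  have e2 : ∫ x in Ω, Y x * ψ x = ∫ x in K, Y x * ψ x :=
    setIntegral_eq_of_subset_of_forall_diff_eq_zero hΩ hKΩ
      fun x hx => by rw [h0 x hx.2, mul_zero]
  simp_rw [e1, e2]
  obtain ⟨M, hM⟩ := hψ.bounded_above_of_compact_support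
    (hK.of_isClosed_subset (isClosed_tsupport _) hψK)
  refine tendsto_integral_of_L1 _ (hY.mul_continuousOn hψ.continuousOn hK).aestronglyMeasurable
    (Eventually.of_forall fun n => (hX n).mul_continuousOn hψ.continuousOn hK) ?_
  have h2 := ENNReal.Tendsto.const_mul h (Or.inr (ENNReal.ofReal_ne_top (r := M)))
  rw [mul_zero] at h2
  refine tendsto_of_tendsto_of_tendsto_of_le_of_le tendsto_const_nhds h2 (fun _ => zero_le)
    fun n => ?_
  dsimp only
  rw [← lintegral_const_mul' _ _ ENNReal.ofReal_ne_top]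
  refine lintegral_mono fun x => ?_
  rw [← sub_mul, enorm_mul, mul_comm]
  gcongr
  rw [← ofReal_norm_eq_enorm]
  exact ENNReal.ofReal_le_ofReal (hM x)

/-- Leibniz rule for weak derivatives. -/
lemma weak_leibniz {d m : ℕ} {p : ℝ} (hp : 1 ≤ p) {C : ℝ≥0} (hC : BilEst d m p C)
    {Ω : Set (Ed d)} (hΩ : IsOpen Ω) {u v : Ed d → ℝ} {D E : (Fin d → ℕ) → Ed d → ℝ}
    (hu : LocData d m p Ω u D) (hv : LocData d m p Ω v E) {γ : Fin d → ℕ} (hγ : ord γ ≤ m)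
    {L : List ((Fin d → ℕ) × (Fin d → ℕ))} (hL : ∀ q ∈ L, ord q.1 + ord q.2 = ord γ)
    (hLs : ∀ f g : Ed d → ℝ, Sm f → Sm g → pderivA d γ (f * g) =
      lsum L (fun β => pderivA d β f) (fun β => pderivA d β g)) :
    HasWeakDerivOn d Ω γ (u * v) (lsum L D E) := by
  have h00 : ord (0 : Fin d → ℕ) + ord (0 : Fin d → ℕ) ≤ m := by simp [ord]
  have h0 : (0 : Fin d → ℕ) ∈ multiIdx d m := mem_multiIdx.2 (by simp [ord])
  have hDu := weak_unique hΩ (hu.wk 0 h0) (weak_zero (hu.wk 0 h0).1)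
  have hEv := weak_unique hΩ (hv.wk 0 h0) (weak_zero (hv.wk 0 h0).1)
  have hDE : D 0 * E 0 =ᵐ[volume.restrict Ω] u * v := hDu.mul hEv
  have hi0 := loc_int hp hC hΩ hu hv h00
  have hiL : LocallyIntegrableOn (lsum L D E) Ω volume :=
    lsum_int L D E Ω fun q hq => loc_int hp hC hΩ hu hv ((hL q hq).trans_le hγ)
  refine ⟨?_, hiL, fun φ hφ => ?_⟩
  · rw [locallyIntegrableOn_iff hΩ.isLocallyClosed] at hi0 ⊢
    intro k hk hkc
    exact (hi0 k hk hkc).congr (ae_restrict_of_ae_restrict_of_subset hk hDE)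
  have hK : IsCompact (tsupport φ) := hφ.2.1
  obtain ⟨w, z, hw, hz, hlim⟩ := loc_L1 hp hC hΩ hK hφ.2.2 hu hv
  have smw : ∀ n β, Continuous (pderivA d β (w n)) := fun n β => (sm_pderivA β (hw n)).continuous
  have smz : ∀ n β, Continuous (pderivA d β (z n)) := fun n β => (sm_pderivA β (hz n)).continuous
  have t1 := pair_tendsto hK hφ.2.2 hΩ.measurableSet (sm_pderivA γ hφ.1).continuous
    (pderivA_tsupport γ hφ.1)
    (X := fun n => pderivA d 0 (w n) * pderivA d 0 (z n)) (Y := D 0 * E 0)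
    (fun n => ((smw n 0).mul (smz n 0)).continuousOn.integrableOn_compact hK)
    (hi0.integrableOn_compact_subset hφ.2.2 hK) (hlim 0 0 h00)
  have hsml : ∀ n, Continuous (lsum L (fun β => pderivA d β (w n)) (fun β => pderivA d β (z n))) :=
    fun n => by
      rw [← hLs _ _ (hw n) (hz n)]
      exact (sm_pderivA _ (sm_mul (hw n) (hz n))).continuous
  have t2 := pair_tendsto hK hφ.2.2 hΩ.measurableSet hφ.1.continuous subset_rfl
    (X := fun n => lsum L (fun β => pderivA d β (w n)) (fun β => pderivA d β (z n)))
    (Y := lsum L D E)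
    (fun n => (hsml n).continuousOn.integrableOn_compact hK)
    (hiL.integrableOn_compact_subset hφ.2.2 hK)
    (lsum_L1 L D E (fun n β => pderivA d β (w n)) (fun n β => pderivA d β (z n))
      (fun n q hq => ((smw n q.1).mul (smz n q.2)).aestronglyMeasurable.sub
        ((loc_int hp hC hΩ hu hv ((hL q hq).trans_le hγ)).integrableOn_compact_subset
          hφ.2.2 hK).aestronglyMeasurable)
      (fun q hq => hlim q.1 q.2 ((hL q hq).trans_le hγ)))
  have e : ∀ n, ∫ x, (pderivA d 0 (w n) * pderivA d 0 (z n)) x * pderivA d γ φ x =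
      (-1 : ℝ) ^ (ord γ) * ∫ x, lsum L (fun β => pderivA d β (w n)) (fun β => pderivA d β (z n)) x
        * φ x := by
    intro n
    rw [← hLs _ _ (hw n) (hz n), pderivA_zero, pderivA_zero]
    exact pderivA_ibp γ (sm_mul (hw n) (hz n)) hφ.1 hφ.2.1
  have t3 := t2.const_mul ((-1 : ℝ) ^ ord γ)
  simp_rw [e] at t1
  have := tendsto_nhds_unique t1 t3
  have e3 : ∫ x in Ω, (u * v) x * pderivA d γ φ x = ∫ x in Ω, (D 0 * E 0) x * pderivA d γ φ x :=
    integral_congr_ae (by filter_upwards [hDE] with x hx; rw [hx])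
  rw [e3]
  exact this

/-- The properties of the weight used in the proof. -/
structure Wt (d : ℕ) (Ω : Set (Ed d)) (ρ : Ed d → ℝ) : Prop where
  lip : ∀ x y, ρ x ≤ ρ y + dist x y
  le1 : ∀ x, ρ x ≤ 1
  pos : ∀ x, x ∈ Ω ↔ 0 < ρ x

lemma Wt.cont {d : ℕ} {Ω : Set (Ed d)} {ρ : Ed d → ℝ} (h : Wt d Ω ρ) : Continuous ρ := by
  have : LipschitzWith 1 ρ := LipschitzWith.of_le_add fun x y => h.lip x y
  exact this.continuous

lemma Wt.isOpen {d : ℕ} {Ω : Set (Ed d)} {ρ : Ed d → ℝ} (h : Wt d Ω ρ) : IsOpen Ω := by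
  have : Ω = ρ ⁻¹' Ioi 0 := by ext x; exact h.pos x
  rw [this]
  exact isOpen_Ioi.preimage h.cont

/-- The Kondratiev integrand as an extended nonnegative function. -/
def GK (d : ℕ) (ρ : Ed d → ℝ) (a p : ℝ) (α : Fin d → ℕ) (v : Ed d → ℝ) (x : Ed d) : ℝ≥0∞ :=
  ENNReal.ofReal (kIntegrand d ρ a p α v x)

/-- The weighted function. -/
def wf (d : ℕ) (ρ : Ed d → ℝ) (a : ℝ) (α : Fin d → ℕ) (v : Ed d → ℝ) (x : Ed d) : ℝ :=
  ρ x ^ ((ord α : ℝ) - a) * v x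

lemma GK_eq {d : ℕ} {Ω : Set (Ed d)} {ρ : Ed d → ℝ} (h : Wt d Ω ρ) {a p : ℝ} (hp : 0 ≤ p)
    (α : Fin d → ℕ) (v : Ed d → ℝ) {x : Ed d} (hx : x ∈ Ω) :
    GK d ρ a p α v x = ‖wf d ρ a α v x‖ₑ ^ p := by
  have h0 : 0 < ρ x := (h.pos x).1 hx
  rw [GK, kIntegrand, wf, ← ENNReal.ofReal_rpow_of_nonneg (by positivity) hp,
    ← ofReal_norm, norm_mul, Real.norm_of_nonneg (by positivity)]
  rfl

lemma eLp_wf {d : ℕ} {Ω : Set (Ed d)} {ρ : Ed d → ℝ} (h : Wt d Ω ρ) {a p : ℝ} (hp : 1 ≤ p)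
    (α : Fin d → ℕ) (v : Ed d → ℝ) {S : Set (Ed d)} (hS : MeasurableSet S) (hSΩ : S ⊆ Ω) :
    eLpNorm (wf d ρ a α v) (ENNReal.ofReal p) (volume.restrict S) =
      (∫⁻ x in S, GK d ρ a p α v x) ^ (1 / p) := by
  have hp0 : 0 < p := by linarith
  rw [eLpNorm_eq_lintegral_rpow_enorm_toReal (by simpa using hp0) ENNReal.ofReal_ne_top,
      ENNReal.toReal_ofReal hp0.le]
  congr 1
  refine setLIntegral_congr_fun hS fun x hx => ?_
  exact (GK_eq h hp0.le α v (hSΩ hx)).symm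

lemma ratio_rpow {x y : ℝ} (hx : 0 < x) (hy : 0 < y) (h1 : x ≤ 10 * y) (h2 : y ≤ 10 * x) (s : ℝ) :
    x ^ s ≤ 10 ^ |s| * y ^ s := by
  rcases le_total 0 s with hs | hs
  · rw [abs_of_nonneg hs, ← Real.mul_rpow (by norm_num) hy.le]
    exact Real.rpow_le_rpow hx.le h1 hs
  · rw [abs_of_nonpos hs, Real.rpow_neg (by norm_num), ← Real.inv_rpow (by norm_num),
      ← Real.mul_rpow (by norm_num) hy.le]
    exact Real.rpow_le_rpow_of_nonpos (by positivity) (by linarith) hs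

/-- The comparison constant. -/
def KK (m : ℕ) (a : ℝ) : ℝ≥0 := ⟨10 ^ ((m : ℝ) + |a|), by positivity⟩

lemma ratio_KK {m : ℕ} {a : ℝ} {k : ℕ} (hk : k ≤ m) {x y : ℝ} (hx : 0 < x) (hy : 0 < y)
    (h1 : x ≤ 10 * y) (h2 : y ≤ 10 * x) :
    x ^ ((k : ℝ) - a) ≤ KK m a * y ^ ((k : ℝ) - a) := by
  refine (ratio_rpow hx hy h1 h2 _).trans ?_
  have : (10 : ℝ) ^ |(k : ℝ) - a| ≤ 10 ^ ((m : ℝ) + |a|) := by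
    refine Real.rpow_le_rpow_of_exponent_le (by norm_num) ?_
    have h3 := abs_sub (k : ℝ) a
    have h4 : |(k : ℝ)| = k := abs_of_nonneg (by positivity)
    have h5 : (k : ℝ) ≤ m := by exact_mod_cast hk
    linarith
  exact mul_le_mul_of_nonneg_right this (by positivity)

lemma Wt.comp {d : ℕ} {Ω : Set (Ed d)} {ρ : Ed d → ℝ} (h : Wt d Ω ρ) {y x : Ed d} (hy : y ∈ Ω)
    (hx : x ∈ closedBall y (2 * (ρ y / 8))) :
    0 < ρ x ∧ ρ x ≤ 10 * (ρ y / 8) ∧ ρ y / 8 ≤ 10 * ρ x := by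
  have h0 := (h.pos y).1 hy
  have h1 := h.lip x y
  have h2 := h.lip y x
  rw [mem_closedBall] at hx
  rw [dist_comm y x] at h2
  refine ⟨by linarith, by linarith, by linarith⟩

lemma Wt.sub {d : ℕ} {Ω : Set (Ed d)} {ρ : Ed d → ℝ} (h : Wt d Ω ρ) {y : Ed d} (hy : y ∈ Ω) :
    closedBall y (2 * (ρ y / 8)) ⊆ Ω := fun x hx => (h.pos x).2 (h.comp hy hx).1

/-- Local Kondratiev norm (to the power `p`). -/
def TK (d m : ℕ) (ρ : Ed d → ℝ) (a p : ℝ) (D : (Fin d → ℕ) → Ed d → ℝ) (S : Set (Ed d)) : ℝ≥0∞ :=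
  ∑ α ∈ multiIdx d m, ∫⁻ x in S, GK d ρ a p α (D α) x

lemma Wr_le_TK {d m : ℕ} {Ω : Set (Ed d)} {ρ : Ed d → ℝ} (h : Wt d Ω ρ) {a p : ℝ} (hp : 1 ≤ p)
    (D : (Fin d → ℕ) → Ed d → ℝ) {y : Ed d} (hy : y ∈ Ω) :
    ENNReal.ofReal ((ρ y / 8) ^ (-a)) * Wr d m p y (ρ y / 8) D ≤
      (multiIdx d m).card * (KK m a * TK d m ρ a p D (closedBall y (2 * (ρ y / 8))) ^ (1 / p)) := by
  have h0 := (h.pos y).1 hy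
  set r := ρ y / 8 with hr
  have hr0 : 0 < r := by positivity
  rw [Wr, Finset.mul_sum, ← nsmul_eq_mul]
  refine Finset.sum_le_card_nsmul _ _ _ fun α hα => ?_
  rw [← mul_assoc, ← ENNReal.ofReal_mul (by positivity), ← Real.rpow_natCast,
    ← Real.rpow_add hr0, neg_add_eq_sub]
  have hpos : (0 : ℝ) ≤ r ^ ((ord α : ℝ) - a) := by positivity
  have e : ENNReal.ofReal (r ^ ((ord α : ℝ) - a)) * eLpNorm (D α) (ENNReal.ofReal p)
      (volume.restrict (closedBall y (2 * r))) = eLpNorm ((r ^ ((ord α : ℝ) - a)) • D α)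
      (ENNReal.ofReal p) (volume.restrict (closedBall y (2 * r))) := by
    rw [eLpNorm_const_smul, Real.enorm_eq_ofReal hpos]
  rw [e]
  have h2 : eLpNorm ((r ^ ((ord α : ℝ) - a)) • D α)
      (ENNReal.ofReal p) (volume.restrict (closedBall y (2 * r))) ≤
      KK m a • eLpNorm (wf d ρ a α (D α)) (ENNReal.ofReal p)
        (volume.restrict (closedBall y (2 * r))) := by
    refine eLpNorm_le_nnreal_smul_eLpNorm_of_ae_le_mul ?_ _
    filter_upwards [ae_restrict_mem measurableSet_closedBall] with x hx
    obtain ⟨c1, c2, c3⟩ := h.comp hy hx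
    rw [← NNReal.coe_le_coe]
    simp only [Pi.smul_apply, smul_eq_mul, nnnorm_mul, NNReal.coe_mul, coe_nnnorm, wf]
    rw [Real.norm_of_nonneg hpos, Real.norm_of_nonneg (show (0:ℝ) ≤ ρ x ^ ((ord α : ℝ) - a) by positivity), ← mul_assoc]
    exact mul_le_mul_of_nonneg_right (ratio_KK (mem_multiIdx.1 hα) hr0 c1 c3 c2) (norm_nonneg _)
  refine h2.trans ?_
  rw [ENNReal.smul_def, smul_eq_mul, eLp_wf h hp _ _ measurableSet_closedBall (h.sub hy)]
  gcongr
  exact Finset.single_le_sum (f := fun α => ∫⁻ x in closedBall y (2 * r), GK d ρ a p α (D α) x)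
    (fun _ _ => zero_le) hα

/-- Local constant. -/
def C3 (d m : ℕ) (a p : ℝ) (C : ℝ≥0) (n : ℕ) : ℝ≥0∞ :=
  (KK m a * n * C * ((multiIdx d m).card * KK m a) * ((multiIdx d m).card * KK m a)) ^ p

lemma C3_ne_top (d m : ℕ) (a p : ℝ) (hp : 0 ≤ p) (C : ℝ≥0) (n : ℕ) : C3 d m a p C n ≠ ⊤ := by
  refine ENNReal.rpow_ne_top_of_nonneg hp ?_
  finiteness

lemma loc_final {d m : ℕ} {a p : ℝ} (hp : 1 ≤ p) (ha : (d : ℝ) / p ≤ a) {C : ℝ≥0}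
    (hC : BilEst d m p C)
    {Ω : Set (Ed d)} {ρ : Ed d → ℝ} (h : Wt d Ω ρ) {u v : Ed d → ℝ}
    {D E : (Fin d → ℕ) → Ed d → ℝ}
    (hu : LocData d m p Ω u D) (hv : LocData d m p Ω v E) {γ : Fin d → ℕ} (hγ : ord γ ≤ m)
    {L : List ((Fin d → ℕ) × (Fin d → ℕ))} (hL : ∀ q ∈ L, ord q.1 + ord q.2 = ord γ)
    {y : Ed d} (hy : y ∈ Ω) :
    ∫⁻ x in ball y (ρ y / 8), GK d ρ a p γ (lsum L D E) x ≤
      C3 d m a p C L.length * (TK d m ρ a p D (closedBall y (2 * (ρ y / 8))) *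
        TK d m ρ a p E (closedBall y (2 * (ρ y / 8)))) := by
  have hp0 : 0 < p := by linarith
  have h0 := (h.pos y).1 hy
  have hWD := Wr_le_TK (m := m) (a := a) h hp D hy
  have hWE := Wr_le_TK (m := m) (a := a) h hp E hy
  have hsubB : ball y (ρ y / 8) ⊆ closedBall y (2 * (ρ y / 8)) :=
    ball_subset_closedBall.trans (closedBall_subset_closedBall (by linarith))
  have hsub := h.sub hy
  have hcomp := fun x hx => h.comp (x := x) hy hx
  have hrle : ρ y / 8 ≤ 1 := by linarith [h.le1 y]
  set r := ρ y / 8 with hr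
  have hr0 : 0 < r := by positivity
  set c := ENNReal.ofReal (r ^ ord γ) with hc
  have hc0 : c ≠ 0 := by rw [hc]; simp; positivity
  have hct : c ≠ ⊤ := ENNReal.ofReal_ne_top
  set κ := ENNReal.ofReal (r ^ (-((d : ℝ) / p))) with hκ
  set A := Wr d m p y r D
  set B := Wr d m p y r E
  set TD := TK d m ρ a p D (closedBall y (2 * r))
  set TE := TK d m ρ a p E (closedBall y (2 * r))
  set s := ENNReal.ofReal (r ^ (-a)) with hs
  have h2 : c * eLpNorm (lsum L D E) (ENNReal.ofReal p) (volume.restrict (ball y r)) ≤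
      L.length * (C * κ * (A * B)) := by
    have hq := fun q (hq : q ∈ L) => loc_prod hp hC h.isOpen hu hv hr0 hsub
      ((hL q hq).trans_le hγ)
    have := (eLp_lsum_le L D E (p := ENNReal.ofReal p) (by simpa using hp)
      (volume.restrict (ball y r)) (c⁻¹ * (C * κ * (A * B))) (fun q h' => (hq q h').1.1)
      (fun q h' => by
        rw [← ENNReal.mul_le_iff_le_inv hc0 hct]
        have := (hq q h').2
        rwa [hL q h'] at this)).2
    rw [ENNReal.mul_le_iff_le_inv hc0 hct]
    exact this.trans (le_of_eq (by ring))
  have h1 : eLpNorm (wf d ρ a γ (lsum L D E)) (ENNReal.ofReal p) (volume.restrict (ball y r)) ≤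
      KK m a * (s * (c * eLpNorm (lsum L D E) (ENNReal.ofReal p) (volume.restrict (ball y r)))) := by
    have hpos : (0 : ℝ) ≤ r ^ ((ord γ : ℝ) - a) := by positivity
    rw [← mul_assoc s, hs, hc, ← ENNReal.ofReal_mul (by positivity), ← Real.rpow_natCast,
      ← Real.rpow_add hr0, neg_add_eq_sub, ← Real.enorm_eq_ofReal hpos, ← eLpNorm_const_smul,
      ← smul_eq_mul, ← ENNReal.smul_def]
    refine eLpNorm_le_nnreal_smul_eLpNorm_of_ae_le_mul ?_ _
    filter_upwards [ae_restrict_mem measurableSet_ball] with x hx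
    obtain ⟨c1, c2, c3⟩ := hcomp x (hsubB hx)
    rw [← NNReal.coe_le_coe]
    simp only [Pi.smul_apply, smul_eq_mul, nnnorm_mul, NNReal.coe_mul, coe_nnnorm, wf]
    rw [Real.norm_of_nonneg hpos, Real.norm_of_nonneg (show (0:ℝ) ≤ ρ x ^ ((ord γ : ℝ) - a) by positivity), ← mul_assoc]
    exact mul_le_mul_of_nonneg_right (ratio_KK hγ c1 hr0 c2 c3) (norm_nonneg _)
  have hsκ : κ ≤ s := by
    refine ENNReal.ofReal_le_ofReal ?_
    exact Real.rpow_le_rpow_of_exponent_ge hr0 hrle (by linarith)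
  rw [eLp_wf h hp _ _ measurableSet_ball (hsubB.trans hsub)] at h1
  have h3 : (∫⁻ x in ball y r, GK d ρ a p γ (lsum L D E) x) ^ (1 / p) ≤
      (KK m a * L.length * C * ((multiIdx d m).card * KK m a) * ((multiIdx d m).card * KK m a)) *
      (TD ^ (1 / p) * TE ^ (1 / p)) := by
    calc _ ≤ _ := h1
      _ ≤ KK m a * (s * (L.length * (C * s * (A * B)))) := by
        refine mul_le_mul' le_rfl (mul_le_mul' le_rfl (h2.trans ?_))
        gcongr
      _ = KK m a * L.length * C * ((s * A) * (s * B)) := by ring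
      _ ≤ KK m a * L.length * C * (((multiIdx d m).card * (KK m a * TD ^ (1 / p))) *
          ((multiIdx d m).card * (KK m a * TE ^ (1 / p)))) := by gcongr
      _ = _ := by ring
  have h4 := ENNReal.rpow_le_rpow h3 hp0.le
  rw [← ENNReal.rpow_mul, one_div, inv_mul_cancel₀ hp0.ne', ENNReal.rpow_one,
    ENNReal.mul_rpow_of_nonneg _ _ hp0.le, ENNReal.mul_rpow_of_nonneg (TD ^ p⁻¹) (TE ^ p⁻¹) hp0.le,
    ← ENNReal.rpow_mul, ← ENNReal.rpow_mul, inv_mul_cancel₀ hp0.ne', ENNReal.rpow_one,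
    ENNReal.rpow_one] at h4
  exact h4

/-- Averaging kernel. -/
def kav (d : ℕ) (ρ : Ed d → ℝ) (y : Ed d) : ℝ≥0∞ := ENNReal.ofReal ((ρ y ^ d)⁻¹)

lemma swap_gen {d : ℕ} {Ω : Set (Ed d)} {ρ : Ed d → ℝ} (h : Wt d Ω ρ) {P : Set (Ed d × Ed d)}
    (hP : MeasurableSet P) (hsub : ∀ y ∈ Ω, {x | (y, x) ∈ P} ⊆ Ω) {H : Ed d → ℝ≥0∞}
    (hH : AEMeasurable H (volume.restrict Ω)) (hHt : ∀ x, H x ≠ ⊤) :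
    ∫⁻ y in Ω, kav d ρ y * ∫⁻ x in {x | (y, x) ∈ P}, H x =
      ∫⁻ x in Ω, (∫⁻ y in {y | y ∈ Ω ∧ (y, x) ∈ P}, kav d ρ y) * H x := by
  have hk : Measurable (kav d ρ) := by
    unfold kav
    have := h.cont.measurable
    fun_prop
  have hΩ := h.isOpen.measurableSet
  have e1 : ∫⁻ y in Ω, kav d ρ y * ∫⁻ x in {x | (y, x) ∈ P}, H x =
      ∫⁻ y in Ω, ∫⁻ x in Ω, kav d ρ y * (P.indicator (fun _ => (1 : ℝ≥0∞)) (y, x) * H x) := by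
    refine setLIntegral_congr_fun hΩ fun y hy => ?_
    have hS : MeasurableSet {x | (y, x) ∈ P} := measurable_prodMk_left hP
    show kav d ρ y * _ = _
    rw [lintegral_const_mul' (kav d ρ y) _ ENNReal.ofReal_ne_top]
    congr 1
    have : ∀ x, P.indicator (fun _ => (1 : ℝ≥0∞)) (y, x) * H x = {x | (y, x) ∈ P}.indicator H x := by
      intro x
      by_cases hx : (y, x) ∈ P <;> simp [hx]
    simp_rw [this]
    rw [lintegral_indicator hS, Measure.restrict_restrict hS, inter_eq_left.2 (hsub y hy)]
  have e2 : ∫⁻ x in Ω, (∫⁻ y in {y | y ∈ Ω ∧ (y, x) ∈ P}, kav d ρ y) * H x =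
      ∫⁻ x in Ω, ∫⁻ y in Ω, kav d ρ y * (P.indicator (fun _ => (1 : ℝ≥0∞)) (y, x) * H x) := by
    refine setLIntegral_congr_fun hΩ fun x hx => ?_
    have hS : MeasurableSet {y | (y, x) ∈ P} := measurable_prodMk_right hP
    show _ * H x = _
    have : ∀ y, kav d ρ y * (P.indicator (fun _ => (1 : ℝ≥0∞)) (y, x) * H x) =
        {y | (y, x) ∈ P}.indicator (kav d ρ) y * H x := by
      intro y
      by_cases hx : (y, x) ∈ P <;> simp [hx]
    simp_rw [this]
    rw [lintegral_mul_const' _ _ (hHt x), lintegral_indicator hS, Measure.restrict_restrict hS]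
    congr 3
    ext y
    simp [and_comm]
  rw [e1, e2]
  refine lintegral_lintegral_swap ?_
  have h1 : AEMeasurable (fun z : Ed d × Ed d => kav d ρ z.1)
      ((volume.restrict Ω).prod (volume.restrict Ω)) := (hk.comp measurable_fst).aemeasurable
  have h2 : AEMeasurable (fun z : Ed d × Ed d => P.indicator (fun _ => (1 : ℝ≥0∞)) z)
      ((volume.restrict Ω).prod (volume.restrict Ω)) :=
    (measurable_const.indicator hP).aemeasurable
  have h3 : AEMeasurable (fun z : Ed d × Ed d => H z.2)
      ((volume.restrict Ω).prod (volume.restrict Ω)) := hH.comp_snd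
  exact h1.mul (h2.mul h3)

/-- Lower averaging constant. -/
def c1av (d : ℕ) : ℝ≥0∞ := ENNReal.ofReal ((1 / 32) ^ d) * volume (ball (0 : Ed d) 1)

/-- Upper averaging constant. -/
def c2av (d : ℕ) : ℝ≥0∞ := ENNReal.ofReal (2 ^ d) * volume (ball (0 : Ed d) 1)

lemma c1av_ne_zero (d : ℕ) : c1av d ≠ 0 := by
  refine mul_ne_zero (by simp) ?_
  exact (measure_ball_pos volume (0 : Ed d) one_pos).ne'

lemma c1av_ne_top (d : ℕ) : c1av d ≠ ⊤ :=
  ENNReal.mul_ne_top ENNReal.ofReal_ne_top measure_ball_lt_top.ne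

lemma c2av_ne_top (d : ℕ) : c2av d ≠ ⊤ :=
  ENNReal.mul_ne_top ENNReal.ofReal_ne_top measure_ball_lt_top.ne

lemma vol_ball {d : ℕ} (x : Ed d) {r : ℝ} (hr : 0 < r) :
    volume (ball x r) = ENNReal.ofReal (r ^ d) * volume (ball (0 : Ed d) 1) := by
  rw [Measure.addHaar_ball_of_pos _ _ hr, finrank_euclideanSpace_fin]

lemma av_lower {d : ℕ} {Ω : Set (Ed d)} {ρ : Ed d → ℝ} (h : Wt d Ω ρ) {H : Ed d → ℝ≥0∞}
    (hH : AEMeasurable H (volume.restrict Ω)) (hHt : ∀ x, H x ≠ ⊤) :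
    c1av d * ∫⁻ x in Ω, H x ≤ ∫⁻ y in Ω, kav d ρ y * ∫⁻ x in ball y (ρ y / 8), H x := by
  have hP : MeasurableSet {z : Ed d × Ed d | dist z.2 z.1 < ρ z.1 / 8} := by
    refine IsOpen.measurableSet (isOpen_lt (by fun_prop) ?_)
    have := h.cont
    fun_prop
  have e := swap_gen h hP (H := H) (fun y hy x hx =>
    h.sub hy (mem_closedBall.2 (by
      have h0 := (h.pos y).1 hy
      have : dist x y < ρ y / 8 := hx
      linarith))) hH hHt
  have e' : ∫⁻ y in Ω, kav d ρ y * ∫⁻ x in ball y (ρ y / 8), H x =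
    ∫⁻ y in Ω, kav d ρ y * ∫⁻ x in
      {x | (y, x) ∈ {z : Ed d × Ed d | dist z.2 z.1 < ρ z.1 / 8}}, H x := rfl
  rw [e', e, ← lintegral_const_mul' _ _ (c1av_ne_top d)]
  refine setLIntegral_mono_ae' h.isOpen.measurableSet (ae_of_all _ fun x hx => ?_)
  refine mul_le_mul' ?_ le_rfl
  have h0 := (h.pos x).1 hx
  have key : ∀ y ∈ ball x (ρ x / 16), 0 < ρ y ∧ dist x y < ρ y / 8 ∧ ρ y ≤ 2 * ρ x := by
    intro y hy
    rw [mem_ball, dist_comm] at hy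
    have h1 := h.lip x y
    have h2 := h.lip y x
    rw [dist_comm y x] at h2
    refine ⟨by linarith, by linarith, by linarith⟩
  calc c1av d = ENNReal.ofReal (((2 * ρ x) ^ d)⁻¹) * volume (ball x (ρ x / 16)) := by
        rw [vol_ball x (by positivity), ← mul_assoc, ← ENNReal.ofReal_mul (by positivity), c1av,
          ← inv_pow, ← mul_pow]
        congr 3
        field_simp
        norm_num
    _ = ∫⁻ y in ball x (ρ x / 16), ENNReal.ofReal (((2 * ρ x) ^ d)⁻¹) := by
        rw [setLIntegral_const]
    _ ≤ ∫⁻ y in ball x (ρ x / 16), kav d ρ y := by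
        refine setLIntegral_mono_ae' measurableSet_ball (ae_of_all _ fun y hy => ?_)
        obtain ⟨k1, k2, k3⟩ := key y hy
        refine ENNReal.ofReal_le_ofReal ?_
        gcongr
    _ ≤ _ := by
        refine lintegral_mono_set fun y hy => ?_
        obtain ⟨k1, k2, k3⟩ := key y hy
        exact ⟨(h.pos y).2 k1, k2⟩

lemma av_upper {d : ℕ} {Ω : Set (Ed d)} {ρ : Ed d → ℝ} (h : Wt d Ω ρ) {H : Ed d → ℝ≥0∞}
    (hH : AEMeasurable H (volume.restrict Ω)) (hHt : ∀ x, H x ≠ ⊤) :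
    ∫⁻ y in Ω, kav d ρ y * ∫⁻ x in closedBall y (2 * (ρ y / 8)), H x ≤
      c2av d * ∫⁻ x in Ω, H x := by
  have hP : MeasurableSet {z : Ed d × Ed d | dist z.2 z.1 ≤ 2 * (ρ z.1 / 8)} := by
    refine IsClosed.measurableSet (isClosed_le (by fun_prop) ?_)
    have := h.cont
    fun_prop
  have e := swap_gen h hP (H := H) (fun y hy x hx => h.sub hy hx) hH hHt
  have e' : ∫⁻ y in Ω, kav d ρ y * ∫⁻ x in closedBall y (2 * (ρ y / 8)), H x =
    ∫⁻ y in Ω, kav d ρ y * ∫⁻ x in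
      {x | (y, x) ∈ {z : Ed d × Ed d | dist z.2 z.1 ≤ 2 * (ρ z.1 / 8)}}, H x := rfl
  rw [e', e, ← lintegral_const_mul' _ _ (c2av_ne_top d)]
  refine setLIntegral_mono_ae' h.isOpen.measurableSet (ae_of_all _ fun x hx => ?_)
  refine mul_le_mul' ?_ le_rfl
  have h0 := (h.pos x).1 hx
  have key : ∀ y, y ∈ Ω ∧ dist x y ≤ 2 * (ρ y / 8) → 0 < ρ y ∧ dist x y < ρ x ∧ ρ x / 2 ≤ ρ y := by
    intro y hy
    have h0 := (h.pos y).1 hy.1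
    have h1 := h.lip x y
    have h2 := h.lip y x
    have h3 := hy.2
    rw [dist_comm y x] at h2
    refine ⟨by linarith, by linarith, by linarith⟩
  have hm : MeasurableSet {y | y ∈ Ω ∧ dist x y ≤ 2 * (ρ y / 8)} := by
    have := h.cont
    have hc : IsClosed {y | dist x y ≤ 2 * (ρ y / 8)} := isClosed_le (by fun_prop) (by fun_prop)
    exact h.isOpen.measurableSet.inter hc.measurableSet
  calc ∫⁻ y in {y | y ∈ Ω ∧ dist x y ≤ 2 * (ρ y / 8)}, kav d ρ y
      ≤ ∫⁻ y in {y | y ∈ Ω ∧ dist x y ≤ 2 * (ρ y / 8)}, ENNReal.ofReal (((ρ x / 2) ^ d)⁻¹) := by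
        refine setLIntegral_mono_ae' hm (ae_of_all _ fun y hy => ?_)
        obtain ⟨k1, k2, k3⟩ := key y hy
        refine ENNReal.ofReal_le_ofReal ?_
        gcongr
    _ ≤ ∫⁻ y in ball x (ρ x), ENNReal.ofReal (((ρ x / 2) ^ d)⁻¹) := by
        refine lintegral_mono_set fun y hy => ?_
        obtain ⟨k1, k2, k3⟩ := key y hy
        rw [mem_ball, dist_comm]
        exact k2
    _ = c2av d := by
        rw [setLIntegral_const, vol_ball x (by positivity), ← mul_assoc,
          ← ENNReal.ofReal_mul (by positivity), c2av, ← inv_pow, ← mul_pow]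
        congr 3
        field_simp

lemma GK_aem {d : ℕ} {Ω : Set (Ed d)} {ρ : Ed d → ℝ} (h : Wt d Ω ρ) {a p : ℝ} (α : Fin d → ℕ)
    {v : Ed d → ℝ} (hv : AEStronglyMeasurable v (volume.restrict Ω)) :
    AEMeasurable (GK d ρ a p α v) (volume.restrict Ω) := by
  have h1 : AEMeasurable ρ (volume.restrict Ω) := h.cont.measurable.aemeasurable
  have h2 := hv.aemeasurable
  unfold GK kIntegrand
  have h3 : AEMeasurable (fun x => |v x|) (volume.restrict Ω) := h2.norm
  exact (((h1.pow_const _).mul h3).pow_const _).ennreal_ofReal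

lemma glob {d m : ℕ} {a p : ℝ} (hp : 1 ≤ p) (ha : (d : ℝ) / p ≤ a) {C : ℝ≥0}
    (hC : BilEst d m p C)
    {Ω : Set (Ed d)} {ρ : Ed d → ℝ} (h : Wt d Ω ρ) {u v : Ed d → ℝ}
    {D E : (Fin d → ℕ) → Ed d → ℝ}
    (hu : LocData d m p Ω u D) (hv : LocData d m p Ω v E) {γ : Fin d → ℕ} (hγ : ord γ ≤ m)
    {L : List ((Fin d → ℕ) × (Fin d → ℕ))} (hL : ∀ q ∈ L, ord q.1 + ord q.2 = ord γ)
    (hLm : AEStronglyMeasurable (lsum L D E) (volume.restrict Ω))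
    (hE : TK d m ρ a p E Ω ≠ ⊤) :
    ∫⁻ x in Ω, GK d ρ a p γ (lsum L D E) x ≤
      (c1av d)⁻¹ * (C3 d m a p C L.length * c2av d) *
        (TK d m ρ a p D Ω * TK d m ρ a p E Ω) := by
  have hlow := av_lower h (GK_aem h (a := a) (p := p) γ hLm) (fun x => ENNReal.ofReal_ne_top)
  have hDm : ∀ α ∈ multiIdx d m, AEMeasurable (GK d ρ a p α (D α)) (volume.restrict Ω) :=
    fun α hα => GK_aem h α (hu.wk α hα).2.1.aestronglyMeasurable
  set K := C3 d m a p C L.length * TK d m ρ a p E Ω with hK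
  have hup : ∫⁻ y in Ω, kav d ρ y * TK d m ρ a p D (closedBall y (2 * (ρ y / 8))) ≤
      c2av d * TK d m ρ a p D Ω := by
    have hT : ∀ S, S ⊆ Ω → TK d m ρ a p D S =
        ∫⁻ x in S, ∑ α ∈ multiIdx d m, GK d ρ a p α (D α) x := by
      intro S hS
      rw [TK, lintegral_finsetSum']
      intro α hα
      exact (hDm α hα).mono_measure (Measure.restrict_mono_set _ hS)
    rw [hT Ω subset_rfl]
    have e : ∫⁻ y in Ω, kav d ρ y * TK d m ρ a p D (closedBall y (2 * (ρ y / 8))) =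
        ∫⁻ y in Ω, kav d ρ y * ∫⁻ x in closedBall y (2 * (ρ y / 8)),
          ∑ α ∈ multiIdx d m, GK d ρ a p α (D α) x := by
      refine setLIntegral_congr_fun h.isOpen.measurableSet fun y hy => ?_
      show kav d ρ y * _ = _
      rw [hT _ (h.sub hy)]
    rw [e]
    refine av_upper h (Finset.aemeasurable_fun_sum _ hDm) fun x => ?_
    exact ENNReal.sum_ne_top.2 fun α _ => ENNReal.ofReal_ne_top
  rw [mul_assoc, ← ENNReal.mul_le_iff_le_inv (c1av_ne_zero d) (c1av_ne_top d)]
  refine hlow.trans ?_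
  have h1 : ∫⁻ y in Ω, kav d ρ y * ∫⁻ x in ball y (ρ y / 8), GK d ρ a p γ (lsum L D E) x ≤
      ∫⁻ y in Ω, K * (kav d ρ y * TK d m ρ a p D (closedBall y (2 * (ρ y / 8)))) := by
    refine setLIntegral_mono_ae' h.isOpen.measurableSet (ae_of_all _ fun y hy => ?_)
    have h2 := loc_final hp ha hC h hu hv hγ hL hy
    have h3 : TK d m ρ a p E (closedBall y (2 * (ρ y / 8))) ≤ TK d m ρ a p E Ω :=
      Finset.sum_le_sum fun α _ => lintegral_mono_set (h.sub hy)
    calc _ ≤ kav d ρ y * (C3 d m a p C L.length * (TK d m ρ a p D (closedBall y (2 * (ρ y / 8))) *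
          TK d m ρ a p E Ω)) := mul_le_mul' le_rfl (h2.trans (by gcongr))
      _ = _ := by rw [hK]; ring
  refine h1.trans ?_
  have hKt : K ≠ ⊤ := ENNReal.mul_ne_top (C3_ne_top d m a p (by linarith) C _) hE
  rw [lintegral_const_mul' _ _ hKt]
  calc _ ≤ K * (c2av d * TK d m ρ a p D Ω) := mul_le_mul' le_rfl hup
    _ = _ := by rw [hK]; ring

/-- Projection onto the first `d - ℓ` coordinates. -/
def Qp (d ℓ : ℕ) (x : Ed d) : Ed d := WithLp.toLp 2 fun i => if (i : ℕ) < d - ℓ then x i else 0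

lemma Qp_norm (d ℓ : ℕ) (x : Ed d) : ‖Qp d ℓ x‖ =
    Real.sqrt (∑ i ∈ Finset.univ.filter (fun i : Fin d => (i : ℕ) < d - ℓ), (x i) ^ 2) := by
  rw [EuclideanSpace.norm_eq, Finset.sum_filter]
  congr 1
  refine Finset.sum_congr rfl fun i _ => ?_
  by_cases hi : (i : ℕ) < d - ℓ <;> simp [Qp, hi]

lemma Qp_le (d ℓ : ℕ) (x : Ed d) : ‖Qp d ℓ x‖ ≤ ‖x‖ := by
  rw [EuclideanSpace.norm_eq, EuclideanSpace.norm_eq]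
  refine Real.sqrt_le_sqrt (Finset.sum_le_sum fun i _ => ?_)
  by_cases hi : (i : ℕ) < d - ℓ <;> simp [Qp, hi]
  positivity

lemma Qp_add (d ℓ : ℕ) (x y : Ed d) : Qp d ℓ (x + y) = Qp d ℓ x + Qp d ℓ y := by
  ext i
  by_cases hi : (i : ℕ) < d - ℓ <;> simp [Qp, hi]

lemma rho_eq (d ℓ : ℕ) (x : Ed d) : rhoModel d ℓ x = min 1 ‖Qp d ℓ x‖ := by
  rw [rhoModel, Qp_norm]

lemma model_Wt (d ℓ : ℕ) : Wt d (ModelDomain d ℓ) (rhoModel d ℓ) where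
  lip x y := by
    rw [rho_eq, rho_eq]
    have h1 : ‖Qp d ℓ x‖ ≤ ‖Qp d ℓ y‖ + dist x y := by
      have e : x = y + (x - y) := by abel
      calc ‖Qp d ℓ x‖ = ‖Qp d ℓ y + Qp d ℓ (x - y)‖ := by rw [← Qp_add, ← e]
        _ ≤ ‖Qp d ℓ y‖ + ‖Qp d ℓ (x - y)‖ := norm_add_le _ _
        _ ≤ _ := by rw [dist_eq_norm]; gcongr; exact Qp_le _ _ _
    have h2 : 0 ≤ dist x y := dist_nonneg
    rcases le_total 1 ‖Qp d ℓ y‖ with h | h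
    · rw [min_eq_left h]
      exact (min_le_left _ _).trans (by linarith)
    · rw [min_eq_right h]
      exact (min_le_right _ _).trans h1
  le1 x := by rw [rho_eq]; exact min_le_left _ _
  pos x := by
    rw [rho_eq, lt_min_iff, norm_pos_iff]
    simp only [zero_lt_one, true_and]
    rw [ModelDomain, mem_compl_iff, not_iff_not, RStar, mem_setOf_eq]
    constructor
    · intro h
      ext i
      by_cases hi : (i : ℕ) < d - ℓ
      · simp [Qp, hi, h i hi]
      · simp [Qp, hi]
    · intro h i hi
      have := congrArg (fun z : Ed d => z i) h
      simpa [Qp, hi] using this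

lemma kI_nonneg {d : ℕ} {Ω : Set (Ed d)} {ρ : Ed d → ℝ} (h : Wt d Ω ρ) {a p : ℝ} 
    (α : Fin d → ℕ) (v : Ed d → ℝ) {x : Ed d} (hx : x ∈ Ω) : 0 ≤ kIntegrand d ρ a p α v x := by
  have h0 : 0 < ρ x := (h.pos x).1 hx
  unfold kIntegrand
  positivity

lemma TK_data {d m : ℕ} {Ω : Set (Ed d)} {ρ : Ed d → ℝ} (h : Wt d Ω ρ) {a p : ℝ}
    {D : (Fin d → ℕ) → Ed d → ℝ}
    (hD : ∀ α ∈ multiIdx d m, IntegrableOn (kIntegrand d ρ a p α (D α)) Ω volume) :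
    TK d m ρ a p D Ω =
      ENNReal.ofReal (∑ α ∈ multiIdx d m, ∫ x in Ω, kIntegrand d ρ a p α (D α) x) := by
  have hn : ∀ α, 0 ≤ᵐ[volume.restrict Ω] kIntegrand d ρ a p α (D α) := fun α => by
    filter_upwards [ae_restrict_mem h.isOpen.measurableSet] with x hx
    exact kI_nonneg h α _ hx
  rw [ENNReal.ofReal_sum_of_nonneg fun α _ => integral_nonneg_of_ae (hn α), TK]
  refine Finset.sum_congr rfl fun α hα => ?_
  rw [ofReal_integral_eq_lintegral_ofReal (hD α hα) (hn α)]
  rfl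

lemma KMem_loc {d m : ℕ} {Ω : Set (Ed d)} {ρ : Ed d → ℝ} (h : Wt d Ω ρ) {a p : ℝ} (hp : 1 ≤ p)
    {u : Ed d → ℝ} {D : (Fin d → ℕ) → Ed d → ℝ} (hD : KMemData d Ω ρ m a p u D) :
    LocData d m p Ω u D where
  wk := hD.1
  lp α hα S hS hSΩ := by
    have hp0 : 0 < p := by linarith
    have hmeas : AEStronglyMeasurable (D α) (volume.restrict S) :=
      (hD.1 α hα).2.1.aestronglyMeasurable.mono_measure (Measure.restrict_mono_set _ hSΩ)
    have hwf : eLpNorm (wf d ρ a α (D α)) (ENNReal.ofReal p) (volume.restrict S) < ⊤ := by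
      rw [eLp_wf h hp _ _ hS.measurableSet hSΩ]
      refine ENNReal.rpow_lt_top_of_nonneg (by positivity) (ne_of_lt ?_)
      refine lt_of_le_of_lt (lintegral_mono_set hSΩ) ?_
      exact ((hD.2 α hα).lintegral_lt_top)
    have hcont : ContinuousOn (fun x => (ρ x ^ ((ord α : ℝ) - a))⁻¹) S := by
      refine ContinuousOn.inv₀ (h.cont.continuousOn.rpow_const fun x hx => Or.inl ?_) fun x hx => ?_
      · exact ((h.pos x).1 (hSΩ hx)).ne'
      · exact (Real.rpow_pos_of_pos ((h.pos x).1 (hSΩ hx)) _).ne'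
    obtain ⟨M, hM⟩ := hS.exists_bound_of_continuousOn hcont
    refine ⟨hmeas, ?_⟩
    refine lt_of_le_of_lt (eLpNorm_le_mul_eLpNorm_of_ae_le_mul (c := M)
      (g := wf d ρ a α (D α)) ?_ _) (ENNReal.mul_lt_top ENNReal.ofReal_lt_top hwf)
    filter_upwards [ae_restrict_mem hS.measurableSet] with x hx
    have hx0 : 0 < ρ x ^ ((ord α : ℝ) - a) := Real.rpow_pos_of_pos ((h.pos x).1 (hSΩ hx)) _
    have h1 := hM x hx
    rw [wf, norm_mul]
    calc ‖D α x‖ = ‖(ρ x ^ ((ord α : ℝ) - a))⁻¹‖ * (‖ρ x ^ ((ord α : ℝ) - a)‖ * ‖D α x‖) := by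
          rw [← mul_assoc, ← norm_mul, inv_mul_cancel₀ hx0.ne', norm_one, one_mul]
      _ ≤ _ := by gcongr

lemma TK_congr {d m : ℕ} {Ω : Set (Ed d)} {ρ : Ed d → ℝ} {a p : ℝ}
    {F F' : (Fin d → ℕ) → Ed d → ℝ}
    (hF : ∀ α ∈ multiIdx d m, F α =ᵐ[volume.restrict Ω] F' α) :
    TK d m ρ a p F Ω = TK d m ρ a p F' Ω := by
  refine Finset.sum_congr rfl fun α hα => lintegral_congr_ae ?_
  filter_upwards [hF α hα] with x hx
  simp only [GK, kIntegrand, hx]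

lemma main_bound {d m : ℕ} {a p : ℝ} (hp : 1 ≤ p) (ha : (d : ℝ) / p ≤ a) {C : ℝ≥0}
    (hC : BilEst d m p C) {Ω : Set (Ed d)} {ρ : Ed d → ℝ} (h : Wt d Ω ρ) :
    ∃ c : ℝ, 0 < c ∧ ∀ u v : Ed d → ℝ, MemK d Ω ρ m a p u → MemK d Ω ρ m a p v →
      MemK d Ω ρ m a p (u * v) ∧
      Knorm d Ω ρ m a p (u * v) ≤ c * Knorm d Ω ρ m a p u * Knorm d Ω ρ m a p v := by
  have hp0 : 0 < p := by linarith
  choose L hL1 hL2 using fun α : Fin d → ℕ => leibniz α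
  set C5 : ℝ≥0∞ := ∑ γ ∈ multiIdx d m, (c1av d)⁻¹ * (C3 d m a p C (L γ).length * c2av d) with hC5
  have hC5t : C5 ≠ ⊤ := ENNReal.sum_ne_top.2 fun γ _ => ENNReal.mul_ne_top
    (ENNReal.inv_ne_top.2 (c1av_ne_zero d))
    (ENNReal.mul_ne_top (C3_ne_top d m a p hp0.le C _) (c2av_ne_top d))
  refine ⟨C5.toReal ^ (1 / p) + 1, by positivity, fun u v hu hv => ?_⟩
  have hD := hu.choose_spec
  have hE := hv.choose_spec
  set D := hu.choose with hDdef
  set E := hv.choose with hEdef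
  have hDl := KMem_loc h hp hD
  have hEl := KMem_loc h hp hE
  have hTD := TK_data h hD.2
  have hTE := TK_data h hE.2
  have hm : ∀ γ ∈ multiIdx d m, AEStronglyMeasurable (lsum (L γ) D E) (volume.restrict Ω) :=
    fun γ hγ => (lsum_int (L γ) D E Ω fun q hq => loc_int hp hC h.isOpen hDl hEl
      ((hL1 γ q hq).trans_le (mem_multiIdx.1 hγ))).aestronglyMeasurable
  have hg := fun γ (hγ : γ ∈ multiIdx d m) => glob hp ha hC h hDl hEl (mem_multiIdx.1 hγ) (hL1 γ)
    (hm γ hγ) (by rw [hTE]; exact ENNReal.ofReal_ne_top)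
  have hfam : IsWeakDerivFamily d Ω m (u * v) (fun γ => lsum (L γ) D E) := fun γ hγ =>
    weak_leibniz hp hC h.isOpen hDl hEl (mem_multiIdx.1 hγ) (hL1 γ) (hL2 γ)
  have hT : TK d m ρ a p (fun γ => lsum (L γ) D E) Ω ≤
      C5 * (TK d m ρ a p D Ω * TK d m ρ a p E Ω) := by
    rw [hC5, Finset.sum_mul]
    exact Finset.sum_le_sum hg
  have hmem : KMemData d Ω ρ m a p (u * v) (fun γ => lsum (L γ) D E) := by
    refine ⟨hfam, fun γ hγ => ?_⟩
    refine ⟨?_, ?_⟩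
    · have h1 : AEMeasurable ρ (volume.restrict Ω) := h.cont.measurable.aemeasurable
      have h3 : AEMeasurable (fun x => |lsum (L γ) D E x|) (volume.restrict Ω) :=
        (hm γ hγ).aemeasurable.norm
      exact (((h1.pow_const _).mul h3).pow_const _).aestronglyMeasurable
    · rw [hasFiniteIntegral_iff_ofReal]
      · refine lt_of_le_of_lt (hg γ hγ) ?_
        rw [hTD, hTE]
        refine ENNReal.mul_lt_top (lt_of_le_of_lt (Finset.single_le_sum (f := fun γ =>
          (c1av d)⁻¹ * (C3 d m a p C (L γ).length * c2av d)) (fun _ _ => zero_le) hγ)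
          hC5t.lt_top) (ENNReal.mul_lt_top ENNReal.ofReal_lt_top ENNReal.ofReal_lt_top)
      · filter_upwards [ae_restrict_mem h.isOpen.measurableSet] with x hx
        exact kI_nonneg h γ _ hx
  have huv : MemK d Ω ρ m a p (u * v) := ⟨_, hmem⟩
  refine ⟨huv, ?_⟩
  have hF := huv.choose_spec
  rw [Knorm, dif_pos huv, Knorm, dif_pos hu, Knorm, dif_pos hv, ← hDdef, ← hEdef]
  set F := huv.choose
  have hTF := TK_data h hF.2
  have hFF : TK d m ρ a p F Ω = TK d m ρ a p (fun γ => lsum (L γ) D E) Ω :=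
    TK_congr fun α hα => weak_unique h.isOpen (hF.1 α hα) (hfam α hα)
  rw [← hFF, hTF, hTD, hTE] at hT
  have hpos : ∀ G : (Fin d → ℕ) → Ed d → ℝ,
      0 ≤ ∑ α ∈ multiIdx d m, ∫ x in Ω, kIntegrand d ρ a p α (G α) x := fun G =>
    Finset.sum_nonneg fun α _ => setIntegral_nonneg h.isOpen.measurableSet
      fun x hx => kI_nonneg h α _ hx
  have hD0 := hpos D
  have hE0 := hpos E
  have hF0 := hpos F
  simp only [KnormP]
  set SD := ∑ α ∈ multiIdx d m, ∫ x in Ω, kIntegrand d ρ a p α (D α) x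
  set SE := ∑ α ∈ multiIdx d m, ∫ x in Ω, kIntegrand d ρ a p α (E α) x
  set SF := ∑ α ∈ multiIdx d m, ∫ x in Ω, kIntegrand d ρ a p α (F α) x
  rw [← ENNReal.ofReal_toReal hC5t, ← ENNReal.ofReal_mul hD0, ← ENNReal.ofReal_mul (by positivity),
    ENNReal.ofReal_le_ofReal_iff (by positivity)] at hT
  have hp' : 0 ≤ 1 / p := by positivity
  calc SF ^ (1 / p) ≤ (C5.toReal * (SD * SE)) ^ (1 / p) := Real.rpow_le_rpow hF0 hT hp'
    _ = C5.toReal ^ (1 / p) * SD ^ (1 / p) * SE ^ (1 / p) := by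
      rw [Real.mul_rpow (by positivity) (by positivity), Real.mul_rpow hD0 hE0, mul_assoc]
    _ ≤ _ := by
      gcongr
      linarith

/-- Corollary `mult11`(i): if `a ≥ d/p` and either `1 < p < ∞` and `m > d/p`, or `p = 1`
and `m ≥ d`, then `𝒦^m_{a,p}(ℝ^d, ℝ^ℓ_*)` is an algebra with respect to pointwise
multiplication. -/
theorem statement10 (d ℓ m : ℕ) (hd : 2 ≤ d) (hl : ℓ < d) (hm : 1 ≤ m)
    (a p : ℝ) (hp : 1 ≤ p) (ha : (d : ℝ) / p ≤ a)
    (halg : (1 < p ∧ (d : ℝ) / p < m) ∨ (p = 1 ∧ d ≤ m)) :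
    ∃ c : ℝ, 0 < c ∧ ∀ u v : Ed d → ℝ, MemKM d ℓ m a p u → MemKM d ℓ m a p v →
      MemKM d ℓ m a p (u * v) ∧
      KnormM d ℓ m a p (u * v) ≤ c * KnormM d ℓ m a p u * KnormM d ℓ m a p v := by
  obtain ⟨C, hC⟩ := prod_scaled hd hm hp halg
  exact main_bound hp ha hC (model_Wt d ℓ)

end
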